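/- Let L_0, L_1 and L_∞ be three distinct rays emanating from the origin which are not equally spaced, and let 0 ≤ r < R ≤ ∞. Let 𝓕 be the family of all functions meromorphic in the annulus A = {z ∈ ℂ : r < |z| < R} for which all zeros lie on L_0, all 1-points lie on L_1 and all poles lie on L_∞. Then 𝓕 is normal in A. -/

import Mathlib

open Complex Filter Set Topology

noncomputable section

/-- The open ray emanating from the origin with direction angle `θ`. -/
def Ray (θ : ℝ) : Set ℂ :=
  {z : ℂ | ∃ t : ℝ, 0 < t ∧ z = (t : ℂ) * Complex.exp ((θ : ℂ) * Complex.I)}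

/-- Three rays are equally spaced if their direction angles differ pairwise by `2π/3` mod `2π`. -/
def EquallySpaced (L₀ L₁ L₂ : Set ℂ) : Prop :=
  ∃ θ : ℝ, ({L₀, L₁, L₂} : Set (Set ℂ)) =
    {Ray θ, Ray (θ + 2 * Real.pi / 3), Ray (θ + 4 * Real.pi / 3)}

/-- `f` is meromorphic on the open set `U` with pole set `P`. -/
def MeromOn (f : ℂ → ℂ) (P : Set ℂ) (U : Set ℂ) : Prop :=
  P ⊆ U ∧ AnalyticOnNhd ℂ f (U \ P) ∧
    (∀ p ∈ P, Tendsto (fun z => ‖f z‖) (𝓝[≠] p) atTop) ∧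
    ∀ z ∈ U, ¬ AccPt z (𝓟 P)

-- The Riemann-sphere valued map associated with a meromorphic function with pole set `P`:
-- poles are sent to the point at infinity (`Option.none`).
open Classical in
def toSphere (f : ℂ → ℂ) (P : Set ℂ) (z : ℂ) : Option ℂ :=
  if z ∈ P then Option.none else Option.some (f z)

/-- The chordal (spherical) distance on the Riemann sphere `ℂ ∪ {∞} = Option ℂ`. -/
def sphDist : Option ℂ → Option ℂ → ℝ
  | Option.some z, Option.some w =>
      2 * dist z w / (Real.sqrt (1 + ‖z‖ ^ 2) * Real.sqrt (1 + ‖w‖ ^ 2))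
  | Option.some z, Option.none => 2 / Real.sqrt (1 + ‖z‖ ^ 2)
  | Option.none, Option.some w => 2 / Real.sqrt (1 + ‖w‖ ^ 2)
  | Option.none, Option.none => 0

/-- Local uniform convergence (uniform convergence on compact subsets of `V`) with respect to
the spherical metric. -/
def SphConvOn (F : ℕ → ℂ → Option ℂ) (g : ℂ → Option ℂ) (V : Set ℂ) : Prop :=
  ∀ K : Set ℂ, K ⊆ V → IsCompact K → ∀ ε > (0 : ℝ),
    ∀ᶠ k in atTop, ∀ z ∈ K, sphDist (F k z) (g z) < ε

/-- The family of meromorphic functions (with pole sets) satisfying the membership predicate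
`mem` is normal on `V`: every sequence has a subsequence converging locally uniformly on `V`
with respect to the spherical metric. -/
def NormalOn (mem : (ℂ → ℂ) → Set ℂ → Prop) (V : Set ℂ) : Prop :=
  ∀ (f : ℕ → ℂ → ℂ) (P : ℕ → Set ℂ), (∀ k, mem (f k) (P k)) →
    ∃ φ : ℕ → ℕ, StrictMono φ ∧ ∃ g : ℂ → Option ℂ,
      SphConvOn (fun k => toSphere (f (φ k)) (P (φ k))) g V

/-- Holomorphic logarithm on convex open sets. -/
lemma exists_log_of_convex {U : Set ℂ} (hU : Convex ℝ U) (hUo : IsOpen U) {g : ℂ → ℂ}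
    (hg : DifferentiableOn ℂ g U) (h0 : ∀ z ∈ U, g z ≠ 0) :
    ∃ h : ℂ → ℂ, DifferentiableOn ℂ h U ∧ ∀ z ∈ U, Complex.exp (h z) = g z := by
  rcases U.eq_empty_or_nonempty with rfl | hne
  · exact ⟨0, by simp, by simp⟩
  have hsc : IsSimplyConnected U := by
    have := hU.contractibleSpace hne
    exact (inferInstance : SimplyConnectedSpace U)
  obtain ⟨f, hf, hfe⟩ := exists_continuousOn_eqOn_exp_comp hsc hUo hg.continuousOn
    (by rintro ⟨z, hz, h⟩; exact h0 z hz h)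
  refine ⟨f, ?_, fun z hz => hfe hz⟩
  intro z hz
  have hzU : U ∈ 𝓝 z := hUo.mem_nhds hz
  have hfc : ContinuousAt f z := hf.continuousAt hzU
  have hev : f =ᶠ[𝓝 z] fun w => f z + Complex.log (g w * Complex.exp (-f z)) := by
    have h1 : ∀ᶠ w in 𝓝 z, dist (f w) (f z) < 1 := Metric.tendsto_nhds.mp hfc 1 one_pos
    filter_upwards [h1, hzU] with w hw hwU
    have him : |(f w - f z).im| < 1 := lt_of_le_of_lt (Complex.abs_im_le_norm _)
      (by rwa [← dist_eq_norm])
    rw [abs_lt] at him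
    have := Real.pi_gt_three
    have h2 : g w * Complex.exp (-f z) = Complex.exp (f w - f z) := by
      rw [← hfe hwU, Function.comp_apply, ← Complex.exp_add, sub_eq_add_neg]
    rw [h2, Complex.log_exp (by linarith) (by linarith)]
    ring
  refine (DifferentiableAt.congr_of_eventuallyEq ?_ hev).differentiableWithinAt
  have hgd : DifferentiableAt ℂ g z := hg.differentiableAt hzU
  have hone : g z * Complex.exp (-f z) = 1 := by
    rw [← hfe hz, Function.comp_apply, ← Complex.exp_add]; simp
  refine (differentiableAt_const _).add ((hgd.mul_const _).clog ?_)
  rw [hone]; exact Complex.one_mem_slitPlane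

/-- Weak Bloch theorem. -/
lemma bloch_bound {g : ℂ → ℂ} {c : ℂ} {ρ : ℝ} (hρ : 0 < ρ)
    (hg : DifferentiableOn ℂ g (Metric.ball c ρ))
    (hom : ∀ w : ℂ, ∃ p : ℂ, dist p w < 1 ∧ ∀ z ∈ Metric.ball c ρ, g z ≠ p) :
    ‖deriv g c‖ * ρ ≤ 96 := by
  set σ := ρ / 2 with hσ
  have hσ0 : 0 < σ := by positivity
  have hsub : Metric.closedBall c σ ⊆ Metric.ball c ρ :=
    Metric.closedBall_subset_ball (by rw [hσ]; linarith)
  have hg' : DifferentiableOn ℂ (deriv g) (Metric.ball c ρ) := hg.deriv Metric.isOpen_ball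
  obtain ⟨a, ha, hmax⟩ := (isCompact_closedBall c σ).exists_isMaxOn
    (f := fun z => ‖deriv g z‖ * (σ - dist z c)) ⟨c, by simp [hσ0.le]⟩
    (((hg'.continuousOn.mono hsub).norm).mul (by fun_prop))
  have hmc : ‖deriv g c‖ * σ ≤ ‖deriv g a‖ * (σ - dist a c) := by
    have := hmax (show c ∈ Metric.closedBall c σ by simp [hσ0.le])
    simpa using this
  by_contra hcon
  push Not at hcon
  have hM : 48 < ‖deriv g a‖ * (σ - dist a c) := by
    rw [hσ] at hmc ⊢; linarith
  have hda : 0 < σ - dist a c := by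
    by_contra h; push Not at h
    nlinarith [norm_nonneg (deriv g a)]
  have hD : 0 < ‖deriv g a‖ := by
    by_contra h; push Not at h
    nlinarith
  set D := ‖deriv g a‖ with hDdef
  set t := (σ - dist a c) / 2 with ht
  have ht0 : 0 < t := by positivity
  have hDt : 24 < D * t := by rw [ht]; linarith
  have hballt : Metric.ball a t ⊆ Metric.closedBall c σ := by
    intro z hz
    rw [Metric.mem_ball] at hz
    rw [Metric.mem_closedBall]
    have := dist_triangle z a c
    linarith
  have hb1 : ∀ z ∈ Metric.ball a t, ‖deriv g z‖ ≤ 2 * D := by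
    intro z hz
    have h1 := hmax (hballt hz)
    simp only [Set.mem_ofPred_eq] at h1
    rw [Metric.mem_ball] at hz
    have := dist_triangle z a c
    have h2 : t ≤ σ - dist z c := by linarith
    have h3 : ‖deriv g z‖ * t ≤ ‖deriv g z‖ * (σ - dist z c) := by gcongr
    have h4 : D * (σ - dist a c) = (2 * D) * t := by rw [ht]; ring
    have h5 : ‖deriv g z‖ * t ≤ (2 * D) * t := by linarith
    exact le_of_mul_le_mul_right h5 ht0
  have hb2 : ∀ z ∈ Metric.ball a t, dist (deriv g z) (deriv g a) ≤ (3 * D) / t * dist z a := by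
    intro z hz
    refine Complex.dist_le_div_mul_dist_of_mapsTo_ball (hg'.mono (hballt.trans hsub)) ?_ hz
    intro w hw
    rw [Metric.mem_closedBall, dist_eq_norm]
    calc ‖deriv g w - deriv g a‖ ≤ ‖deriv g w‖ + ‖deriv g a‖ := norm_sub_le _ _
      _ ≤ 3 * D := by linarith [hb1 w hw]
  have hs6 : Metric.closedBall a (t / 6) ⊆ Metric.ball a t :=
    Metric.closedBall_subset_ball (by linarith)
  have hb3 : ∀ z ∈ Metric.sphere a (t / 6), D * t / 12 ≤ ‖g z - g a‖ := by
    intro z hz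
    have hz' : z ∈ Metric.closedBall a (t / 6) := Metric.sphere_subset_closedBall hz
    have hd : ∀ w ∈ Metric.closedBall a (t / 6), HasDerivWithinAt (fun w => g w - deriv g a * w)
        (deriv g w - deriv g a) (Metric.closedBall a (t / 6)) w := by
      intro w hw
      have h1 : HasDerivAt g (deriv g w) w :=
        (hg.differentiableAt (Metric.isOpen_ball.mem_nhds (hsub (hballt (hs6 hw))))).hasDerivAt
      have h2 := h1.sub ((hasDerivAt_id w).const_mul (deriv g a))
      simp only [mul_one] at h2
      exact h2.hasDerivWithinAt
    have hb : ∀ w ∈ Metric.closedBall a (t / 6), ‖deriv g w - deriv g a‖ ≤ D / 2 := by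
      intro w hw
      have h1 := hb2 w (hs6 hw)
      rw [Metric.mem_closedBall] at hw
      rw [← dist_eq_norm]
      calc _ ≤ _ := h1
        _ ≤ 3 * D / t * (t / 6) := by gcongr
        _ = D / 2 := by field_simp; ring
    have := (convex_closedBall a (t / 6)).norm_image_sub_le_of_norm_hasDerivWithin_le hd hb
      (show a ∈ Metric.closedBall a (t / 6) by simp; positivity) hz'
    have hza : ‖z - a‖ = t / 6 := by rw [← dist_eq_norm]; exact hz
    rw [hza] at this
    have h5 : ‖deriv g a * (z - a)‖ = D * (t / 6) := by rw [norm_mul, hza]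
    have h6 : ‖deriv g a * (z - a)‖ ≤ ‖g z - g a‖ +
        ‖g z - deriv g a * z - (g a - deriv g a * a)‖ := by
      have : deriv g a * (z - a) = (g z - g a) -
        (g z - deriv g a * z - (g a - deriv g a * a)) := by ring
      rw [this]; exact norm_sub_le _ _
    linarith
  have hcl : DiffContOnCl ℂ g (Metric.ball a (t / 6)) := by
    refine DifferentiableOn.diffContOnCl ?_
    rw [closure_ball a (by positivity)]
    exact hg.mono (hs6.trans (hballt.trans hsub))
  have himg := hcl.ball_subset_image_closedBall (by positivity) hb3 (by
    have h1 : HasDerivAt g (deriv g a) a :=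
      (hg.differentiableAt (Metric.isOpen_ball.mem_nhds (hsub ha))).hasDerivAt
    have h2 := h1.eventually_ne (norm_pos_iff.mp hD) (c := g a)
    have h3 : ∃ᶠ z in 𝓝[≠] a, g z ≠ g a := h2.frequently
    exact h3.filter_mono nhdsWithin_le_nhds)
  obtain ⟨p, hp1, hp2⟩ := hom (g a)
  obtain ⟨z, hz, hzp⟩ := himg (show p ∈ Metric.ball (g a) (D * t / 12 / 2) by
    rw [Metric.mem_ball]; linarith)
  exact hp2 z (hsub (hballt (hs6 hz))) hzp


lemma cosh_net (w : ℂ) : ∃ p : ℂ, dist p w < 4 ∧ ∃ n : ℤ, Complex.cosh p = n := by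
  have hcosh : ∀ x : ℝ, 0 ≤ x → ∃ y : ℝ, |y - x| ≤ 2 ∧ ∃ n : ℤ, Real.cosh y = n := by
    intro x hx
    have h1 : Real.cosh x + 1 ≤ Real.cosh (x + 2) := by
      rw [Real.cosh_add]
      have h2 : 0 ≤ Real.sinh x := Real.sinh_nonneg_iff.mpr hx
      have h3 : 0 ≤ Real.sinh 2 := Real.sinh_nonneg_iff.mpr (by norm_num)
      have h4 : (2 : ℝ) ≤ Real.cosh 2 := by
        have := Real.cosh_eq 2
        have h5 := Real.add_one_le_exp (2 : ℝ)
        have h6 : (2 : ℝ) + 2 ≤ Real.exp 2 := by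
          have := Real.add_one_le_exp (1 : ℝ)
          have h7 : Real.exp 2 = Real.exp 1 * Real.exp 1 := by rw [← Real.exp_add]; norm_num
          rw [h7]; nlinarith
        have := Real.exp_pos (-2)
        linarith
      have h5 := Real.one_le_cosh x
      nlinarith [mul_nonneg h2 h3]
    have hm : ((⌈Real.cosh x⌉ : ℤ) : ℝ) ∈ Icc (Real.cosh x) (Real.cosh (x + 2)) :=
      ⟨Int.le_ceil _, (Int.ceil_lt_add_one _).le.trans h1⟩
    obtain ⟨y, hy, hy2⟩ := intermediate_value_Icc (by linarith : x ≤ x + 2)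
      Real.continuous_cosh.continuousOn hm
    refine ⟨y, ?_, _, hy2⟩
    rw [abs_le]; constructor <;> linarith [hy.1, hy.2]
  have hcosh' : ∃ y : ℝ, |y - w.re| ≤ 2 ∧ ∃ n : ℤ, Real.cosh y = n := by
    rcases le_total 0 w.re with h | h
    · exact hcosh _ h
    · obtain ⟨y, hy, n, hn⟩ := hcosh (-w.re) (by linarith)
      refine ⟨-y, ?_, n, by rwa [Real.cosh_neg]⟩
      rw [← abs_neg]; convert hy using 2; ring
  obtain ⟨y, hy, n, hn⟩ := hcosh'
  set m : ℤ := round (w.im / Real.pi) with hm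
  refine ⟨(y : ℂ) + m * (Real.pi * I), ?_, (-1) ^ m.natAbs * n, ?_⟩
  · rw [dist_eq_norm]
    have him : |m * Real.pi - w.im| ≤ Real.pi / 2 := by
      have h1 := abs_sub_round (w.im / Real.pi)
      rw [← hm] at h1
      have h2 : m * Real.pi - w.im = -((w.im / Real.pi - m) * Real.pi) := by
        field_simp; ring
      rw [h2, abs_neg, abs_mul, abs_of_pos Real.pi_pos]
      nlinarith [Real.pi_pos]
    calc _ ≤ _ := Complex.norm_le_abs_re_add_abs_im _
      _ ≤ 2 + Real.pi / 2 := by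
        refine add_le_add ?_ ?_
        · simpa using hy
        · simpa using him
      _ < 4 := by linarith [Real.pi_lt_four]
  · have h1 : Complex.cosh (y : ℂ) = n := by rw [← Complex.ofReal_cosh, hn]; simp
    rw [Complex.cosh_add, h1]
    have h2 : Complex.sinh ((m : ℂ) * (Real.pi * I)) = 0 := by
      rw [← mul_assoc, Complex.sinh_mul_I, Complex.sin_int_mul_pi, zero_mul]
    have h3 : Complex.cosh ((m : ℂ) * (Real.pi * I)) = (-1) ^ m.natAbs := by
      have h4 : Complex.cos ((m : ℂ) * Real.pi) = (-1) ^ m := by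
        have := Real.cos_int_mul_pi m
        have h5 := congrArg (fun x : ℝ => (x : ℂ)) this
        push_cast at h5
        exact h5
      rw [← mul_assoc, Complex.cosh_mul_I, h4]
      have h6 : ∀ q : ℤ, ((-1 : ℂ)) ^ q = (-1) ^ q.natAbs := by
        intro q
        rcases Int.natAbs_eq q with h | h
        · conv_lhs => rw [h]
          rw [zpow_natCast]
        · conv_lhs => rw [h]
          rw [zpow_neg, zpow_natCast, ← inv_pow]; norm_num
      exact h6 m
    rw [h2, h3]; push_cast; ring

/-- Core estimate (Schottky/Landau type). -/
lemma core_estimate {h : ℂ → ℂ} {c : ℂ} {ρ : ℝ} (hρ : 0 < ρ)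
    (hh : DifferentiableOn ℂ h (Metric.ball c ρ))
    (hom : ∀ z ∈ Metric.ball c ρ, Complex.exp (h z) ≠ 1) :
    ‖deriv h c‖ * ρ ≤ 4000 * (1 + |(h c).re|) := by
  set B := Metric.ball c ρ with hB
  have hBo : IsOpen B := Metric.isOpen_ball
  have hBc : Convex ℝ B := convex_ball c ρ
  have hcB : c ∈ B := Metric.mem_ball_self hρ
  have hpi := Real.pi_pos
  set n : ℤ := round ((h c).im / (2 * Real.pi)) with hn
  set k : ℂ → ℂ := fun z => h z / (2 * Real.pi * I) - n with hk
  have hkd : DifferentiableOn ℂ k B := (hh.div_const _).sub_const _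
  have hpI : (2 * Real.pi * I : ℂ) ≠ 0 := Complex.two_pi_I_ne_zero
  have hkint : ∀ z ∈ B, ∀ m : ℤ, k z ≠ m := by
    intro z hz m hm
    refine hom z hz ?_
    rw [Complex.exp_eq_one_iff]
    refine ⟨m + n, ?_⟩
    have : h z / (2 * Real.pi * I) = m + n := by rw [← hm, hk]; ring
    rw [div_eq_iff hpI] at this
    push_cast; exact this
  obtain ⟨l, hl, hle⟩ := exists_log_of_convex hBc hBo (g := fun z => 1 - k z ^ 2)
    ((differentiableOn_const _).sub (hkd.pow 2)) (by
      intro z hz h0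
      have h1 : (1 - k z) * (1 + k z) = 0 := by rw [← h0]; ring
      rcases mul_eq_zero.mp h1 with h2 | h2
      · exact hkint z hz 1 (by push_cast; linear_combination -h2)
      · exact hkint z hz (-1) (by push_cast; linear_combination h2))
  set s : ℂ → ℂ := fun z => Complex.exp (l z / 2) with hs
  have hsd : DifferentiableOn ℂ s B := (hl.div_const 2).cexp
  have hs2 : ∀ z ∈ B, s z ^ 2 = 1 - k z ^ 2 := by
    intro z hz
    rw [← hle z hz, hs]; simp only
    rw [← Complex.exp_nat_mul]; congr 1; push_cast; ring
  have hprod : ∀ z ∈ B, (k z + I * s z) * (k z - I * s z) = 1 := by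
    intro z hz
    have := hs2 z hz
    linear_combination this - s z ^ 2 * Complex.I_sq
  obtain ⟨L, hL, hLe⟩ := exists_log_of_convex hBc hBo (g := fun z => k z + I * s z)
    (hkd.add (hsd.const_mul I)) (by
      intro z hz h0
      have := hprod z hz
      rw [h0, zero_mul] at this
      exact zero_ne_one this)
  have hLneg : ∀ z ∈ B, Complex.exp (-L z) = k z - I * s z := by
    intro z hz
    rw [Complex.exp_neg, hLe z hz]
    exact inv_eq_of_mul_eq_one_right (hprod z hz)
  have hcoshL : ∀ z ∈ B, Complex.cosh (L z) = k z := by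
    intro z hz
    rw [Complex.cosh, hLe z hz, hLneg z hz]; ring
  have hsinhL : ∀ z ∈ B, Complex.sinh (L z) = I * s z := by
    intro z hz
    rw [Complex.sinh, hLe z hz, hLneg z hz]; ring
  have hbl := bloch_bound (g := fun z => L z / 4) hρ (hL.div_const 4) (by
    intro w
    obtain ⟨p, hp, m, hm⟩ := cosh_net (4 * w)
    refine ⟨p / 4, ?_, ?_⟩
    · rw [dist_eq_norm] at hp ⊢
      have : p / 4 - w = (p - 4 * w) / 4 := by ring
      rw [this, norm_div]; simp; linarith
    · intro z hz he
      have : L z = p := by linear_combination 4 * he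
      exact hkint z hz m (by rw [← hcoshL z hz, this, hm]))
  have hLc : DifferentiableAt ℂ L c := hL.differentiableAt (hBo.mem_nhds hcB)
  rw [deriv_div_const, norm_div] at hbl
  have hbl' : ‖deriv L c‖ * ρ ≤ 384 := by
    have : ‖(4 : ℂ)‖ = 4 := by simp
    rw [this] at hbl; linarith
  have hkL : k =ᶠ[𝓝 c] fun z => Complex.cosh (L z) := by
    filter_upwards [hBo.mem_nhds hcB] with z hz
    exact (hcoshL z hz).symm
  have hk' : deriv k c = Complex.sinh (L c) * deriv L c := by
    rw [hkL.deriv_eq]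
    exact hLc.hasDerivAt.ccosh.deriv
  have hk'' : deriv k c = deriv h c / (2 * Real.pi * I) := by
    rw [hk, deriv_sub_const, deriv_div_const]
  have hh' : deriv h c = 2 * Real.pi * I * (I * s c * deriv L c) := by
    rw [← hsinhL c hcB, ← hk', hk'']; field_simp
  have hkc : ‖k c‖ ≤ 1 / 2 + |(h c).re| := by
    have h1 := abs_sub_round ((h c).im / (2 * Real.pi))
    rw [← hn] at h1
    have h2 : k c = ((h c).im / (2 * Real.pi) - n : ℝ) - ((h c).re / (2 * Real.pi) : ℝ) * I := by
      rw [hk]; simp only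
      conv_lhs => rw [← Complex.re_add_im (h c)]
      push_cast
      field_simp
      linear_combination ((h c).re : ℂ) * Complex.I_sq
    rw [h2]
    refine (norm_sub_le _ _).trans (add_le_add ?_ ?_)
    · rw [Complex.norm_real]; exact h1
    · rw [norm_mul, Complex.norm_I, mul_one, Complex.norm_real, Real.norm_eq_abs, abs_div,
        abs_of_pos (by positivity : 0 < 2 * Real.pi)]
      exact div_le_self (abs_nonneg _) (by linarith [Real.pi_gt_three])
  have hsc : ‖s c‖ ≤ 1 + ‖k c‖ := by
    have h1 : ‖s c‖ ^ 2 ≤ 1 + ‖k c‖ ^ 2 := by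
      rw [← norm_pow, hs2 c hcB]
      refine (norm_sub_le _ _).trans ?_
      simp
    nlinarith [norm_nonneg (k c), norm_nonneg (s c)]
  have hnorm : ‖deriv h c‖ = 2 * Real.pi * ‖s c‖ * ‖deriv L c‖ := by
    rw [hh']; simp [abs_of_pos hpi]; ring
  rw [hnorm]
  have hp4 : Real.pi < 3.15 := Real.pi_lt_d2
  have hs' : ‖s c‖ ≤ 3 / 2 + |(h c).re| := by linarith
  calc 2 * Real.pi * ‖s c‖ * ‖deriv L c‖ * ρ = 2 * Real.pi * ‖s c‖ * (‖deriv L c‖ * ρ) := by ring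
    _ ≤ 2 * 3.15 * (3 / 2 + |(h c).re|) * 384 := by gcongr
    _ ≤ 4000 * (1 + |(h c).re|) := by nlinarith [abs_nonneg (h c).re]

lemma core_exists : ∃ N : ℕ, ∀ (h : ℂ → ℂ) (c : ℂ) (ρ : ℝ), 0 < ρ →
    DifferentiableOn ℂ h (Metric.ball c ρ) →
    (∀ z ∈ Metric.ball c ρ, Complex.exp (h z) ≠ 1) →
    ‖deriv h c‖ * ρ ≤ N * (1 + |(h c).re|) :=
  ⟨4000, fun h c ρ hρ hh hom => by exact_mod_cast core_estimate hρ hh hom⟩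

/-- The constant in the core estimate. -/
def cN : ℕ := Classical.choose core_exists

lemma core {h : ℂ → ℂ} {c : ℂ} {ρ : ℝ} (hρ : 0 < ρ)
    (hh : DifferentiableOn ℂ h (Metric.ball c ρ))
    (hom : ∀ z ∈ Metric.ball c ρ, Complex.exp (h z) ≠ 1) :
    ‖deriv h c‖ * ρ ≤ cN * (1 + |(h c).re|) :=
  Classical.choose_spec core_exists h c ρ hρ hh hom

lemma growth_path {h : ℂ → ℂ} {γ γ' : ℝ → ℂ} {r : ℝ → ℝ} {T : ℝ} (hT : 0 ≤ T)
    (hγ : ∀ t ∈ Icc 0 T, HasDerivAt γ (γ' t) t)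
    (hr : ∀ t ∈ Icc 0 T, 0 < r t)
    (hγr : ∀ t ∈ Icc 0 T, ‖γ' t‖ ≤ r t)
    (hh : ∀ t ∈ Icc 0 T, DifferentiableOn ℂ h (Metric.ball (γ t) (r t)))
    (hom : ∀ t ∈ Icc 0 T, ∀ z ∈ Metric.ball (γ t) (r t), Complex.exp (h z) ≠ 1) :
    1 + |(h (γ T)).re| ≤ (1 + |(h (γ 0)).re|) * Real.exp (cN * T) := by
  have hd : ∀ t ∈ Icc 0 T, HasDerivAt (fun t => (h (γ t)).re)
      ((deriv h (γ t) * γ' t).re) t := by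
    intro t ht
    have h1 : HasDerivAt h (deriv h (γ t)) (γ t) :=
      ((hh t ht).differentiableAt (Metric.ball_mem_nhds _ (hr t ht))).hasDerivAt
    have h2 : HasDerivAt (fun t => h (γ t)) (deriv h (γ t) * γ' t) t := by
      have := h1.scomp t (hγ t ht)
      rw [smul_eq_mul, mul_comm] at this
      exact this
    exact (Complex.reCLM.hasFDerivAt.comp_hasDerivAt t h2)
  have hb : ∀ t ∈ Ico 0 T, ‖(deriv h (γ t) * γ' t).re‖ ≤
      (cN : ℝ) * ‖(h (γ t)).re‖ + cN := by
    intro t ht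
    have ht' : t ∈ Icc 0 T := Ico_subset_Icc_self ht
    calc _ ≤ ‖deriv h (γ t) * γ' t‖ := Complex.abs_re_le_norm _
      _ = ‖deriv h (γ t)‖ * ‖γ' t‖ := norm_mul _ _
      _ ≤ ‖deriv h (γ t)‖ * r t := by gcongr; exact hγr t ht'
      _ ≤ cN * (1 + |(h (γ t)).re|) := core (hr t ht') (hh t ht') (hom t ht')
      _ ≤ _ := by
        rw [Real.norm_eq_abs]
        nlinarith [abs_nonneg (h (γ t)).re]
  have hg := norm_le_gronwallBound_of_norm_deriv_right_le (f := fun t => (h (γ t)).re)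
    (a := 0) (b := T) (δ := |(h (γ 0)).re|)
    (fun t ht => (hd t ht).continuousAt.continuousWithinAt)
    (fun t ht => (hd t (Ico_subset_Icc_self ht)).hasDerivWithinAt) le_rfl hb T ⟨hT, le_rfl⟩
  rw [Real.norm_eq_abs, sub_zero] at hg
  rcases eq_or_ne (cN : ℝ) 0 with h0 | h0
  · rw [h0, gronwallBound_K0] at hg
    rw [h0]; simp at hg ⊢; exact hg
  · rw [gronwallBound_of_K_ne_0 h0] at hg
    simp only [div_self h0] at hg
    linarith

lemma growth_seg {h : ℂ → ℂ} {U : Set ℂ} {a b : ℂ} {ρ : ℝ} (hρ : 0 < ρ)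
    (hU : ∀ c ∈ segment ℝ a b, Metric.ball c ρ ⊆ U)
    (hh : DifferentiableOn ℂ h U) (hom : ∀ z ∈ U, Complex.exp (h z) ≠ 1) :
    1 + |(h b).re| ≤ (1 + |(h a).re|) * Real.exp (cN * (‖b - a‖ / ρ + 1)) := by
  set T := ‖b - a‖ / ρ + 1 with hT
  have hT0 : 0 < T := by positivity
  have hseg : ∀ t ∈ Icc 0 T, a + ((t / T : ℝ) : ℂ) * (b - a) ∈ segment ℝ a b := by
    intro t ht
    rw [segment_eq_image']
    refine ⟨t / T, ⟨div_nonneg ht.1 hT0.le, (div_le_one hT0).mpr ht.2⟩, ?_⟩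
    simp
  have := growth_path (h := h) (γ := fun t => a + ((t / T : ℝ) : ℂ) * (b - a))
    (γ' := fun _ => ((1 / T : ℝ) : ℂ) * (b - a)) (r := fun _ => ρ) hT0.le
    (by
      intro t _
      have h1 : HasDerivAt (fun t : ℝ => ((t / T : ℝ) : ℂ)) ((1 / T : ℝ) : ℂ) t :=
        ((hasDerivAt_id t).div_const T).ofReal_comp
      exact (h1.mul_const (b - a)).const_add a)
    (fun _ _ => hρ)
    (by
      intro t _
      rw [norm_mul, Complex.norm_real, Real.norm_of_nonneg (by positivity), one_div,
        inv_mul_le_iff₀ hT0, hT, add_mul, div_mul_cancel₀ _ hρ.ne']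
      linarith)
    (fun t ht => hh.mono (hU _ (hseg t ht)))
    (fun t ht z hz => hom z (hU _ (hseg t ht) hz))
  simpa [hT0.ne'] using this

lemma circle_upper : ∃ C : ℝ, 0 < C ∧ ∀ h : ℂ → ℂ, DifferentiableOn ℂ h (Metric.ball 0 1) →
    (∀ z ∈ Metric.ball (0 : ℂ) 1, z.im ≠ 0 → Complex.exp (h z) ≠ 1) →
    ∀ z : ℂ, ‖z‖ = 1 / 4 → 0 < z.im →
      ‖deriv h z‖ * (4 * z.im) ^ (cN + 1) ≤ C * (1 + |(h (I / 8)).re|) := by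
  refine ⟨4 * cN * Real.exp (cN * 4) + 1, by positivity, ?_⟩
  intro h hh hom z hz hzi
  set U : Set ℂ := {w | w ∈ Metric.ball (0 : ℂ) 1 ∧ 0 < w.im} with hU
  have hhU : DifferentiableOn ℂ h U := hh.mono fun w hw => hw.1
  have homU : ∀ w ∈ U, Complex.exp (h w) ≠ 1 := fun w hw => hom w hw.1 hw.2.ne'
  have hre : |z.re| ≤ 1 / 4 := hz ▸ Complex.abs_re_le_norm z
  have him : z.im ≤ 1 / 4 := (le_abs_self _).trans (hz ▸ Complex.abs_im_le_norm z)
  have hball : ∀ (c : ℂ) (ρ : ℝ), |c.re| ≤ 1 / 4 → c.im ≤ 1 / 4 → ρ ≤ c.im → 0 < ρ →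
      Metric.ball c ρ ⊆ U := by
    intro c ρ h1 h2 h3 h4 w hw
    rw [Metric.mem_ball, dist_eq_norm] at hw
    have h5 : |(w - c).im| < ρ := lt_of_le_of_lt (Complex.abs_im_le_norm _) hw
    rw [Complex.sub_im, abs_lt] at h5
    refine ⟨?_, by linarith⟩
    rw [Metric.mem_ball, dist_zero_right]
    have h6 : ‖c‖ ≤ 1 / 4 + 1 / 4 :=
      (Complex.norm_le_abs_re_add_abs_im c).trans (add_le_add h1 (by
        rw [abs_of_pos (by linarith)]; exact h2))
    have h7 : ‖w‖ ≤ ‖w - c‖ + ‖c‖ := by simpa using norm_add_le (w - c) c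
    linarith
  set z1 : ℂ := ⟨z.re, 1 / 4⟩ with hz1
  have hs1 : 1 + |(h z1).re| ≤ (1 + |(h (I / 8)).re|) * Real.exp (cN * 4) := by
    have := growth_seg (h := h) (U := U) (a := I / 8) (b := z1) (ρ := 1 / 8) (by norm_num) (by
      intro c hc
      obtain ⟨s, t, hs, ht, hst, rfl⟩ := hc
      refine hball _ _ ?_ ?_ ?_ (by norm_num)
      · simp [hz1]
        rw [abs_of_nonneg ht]
        nlinarith [abs_nonneg z.re]
      · simp [hz1]; nlinarith
      · simp [hz1]; nlinarith) hhU homU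
    refine this.trans ?_
    gcongr
    have : ‖z1 - I / 8‖ ≤ 1 / 4 + 1 / 8 := by
      refine (Complex.norm_le_abs_re_add_abs_im _).trans (add_le_add ?_ ?_)
      · simpa [hz1] using hre
      · simp [hz1]; norm_num
    linarith
  have hy4 : 0 < 4 * z.im := by linarith
  set T := -Real.log (4 * z.im) with hT
  have hT0 : 0 ≤ T := by
    rw [hT]; have := Real.log_nonpos hy4.le (by linarith : 4 * z.im ≤ 1); linarith
  have hpt : ∀ t : ℝ, (z.re : ℂ) + ((Real.exp (-t) / 4 : ℝ) : ℂ) * I =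
      (⟨z.re, Real.exp (-t) / 4⟩ : ℂ) := by
    intro t; generalize Real.exp (-t) / 4 = e; apply Complex.ext <;> simp
  have hs2 := growth_path (h := h) (γ := fun t => (z.re : ℂ) + ((Real.exp (-t) / 4 : ℝ) : ℂ) * I)
    (γ' := fun t => ((-Real.exp (-t) / 4 : ℝ) : ℂ) * I) (r := fun t => Real.exp (-t) / 4) hT0
    (by
      intro t _
      have h1 : HasDerivAt (fun t : ℝ => Real.exp (-t) / 4) (-Real.exp (-t) / 4) t := by
        have := ((hasDerivAt_neg t).exp).div_const 4
        simpa using this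
      exact (h1.ofReal_comp.mul_const I).const_add _)
    (fun t _ => by positivity)
    (by
      intro t _
      rw [norm_mul, Complex.norm_I, mul_one, Complex.norm_real, neg_div, norm_neg,
        Real.norm_of_nonneg (by positivity)])
    (fun t ht => by
      rw [hpt]
      refine hhU.mono (hball _ _ hre ?_ le_rfl (by positivity))
      have : Real.exp (-t) ≤ 1 := Real.exp_le_one_iff.mpr (by linarith [ht.1])
      show Real.exp (-t) / 4 ≤ 1 / 4
      linarith)
    (fun t ht w hw => by
      rw [hpt] at hw
      refine homU w (hball ⟨z.re, Real.exp (-t) / 4⟩ (Real.exp (-t) / 4) hre ?_ le_rfl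
        (by positivity) hw)
      have : Real.exp (-t) ≤ 1 := Real.exp_le_one_iff.mpr (by linarith [ht.1])
      show Real.exp (-t) / 4 ≤ 1 / 4
      linarith)
  simp only [hpt] at hs2
  have hexpT : Real.exp (-T) / 4 = z.im := by
    rw [hT, neg_neg, Real.exp_log hy4]; ring
  rw [hexpT, neg_zero, Real.exp_zero] at hs2
  have hzz : (⟨z.re, z.im⟩ : ℂ) = z := rfl
  rw [hzz, ← hz1] at hs2
  have hpow : Real.exp (cN * T) * (4 * z.im) ^ cN = 1 := by
    rw [Real.exp_nat_mul, ← mul_pow, hT, Real.exp_neg, Real.exp_log hy4, inv_mul_cancel₀ hy4.ne',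
      one_pow]
  have hc := core (h := h) (c := z) (ρ := z.im) hzi (hhU.mono (hball z _ hre him le_rfl hzi))
    (fun w hw => homU w (hball z _ hre him le_rfl hzi hw))
  have hy0 : 0 ≤ (4 * z.im) ^ cN := by positivity
  calc ‖deriv h z‖ * (4 * z.im) ^ (cN + 1) = 4 * ((‖deriv h z‖ * z.im) * (4 * z.im) ^ cN) := by
        rw [pow_succ]; ring
    _ ≤ 4 * ((cN * (1 + |(h z).re|)) * (4 * z.im) ^ cN) := by gcongr
    _ ≤ 4 * ((cN * ((1 + |(h z1).re|) * Real.exp (cN * T))) * (4 * z.im) ^ cN) := by gcongr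
    _ = 4 * (cN * (1 + |(h z1).re|)) * (Real.exp (cN * T) * (4 * z.im) ^ cN) := by ring
    _ = 4 * (cN * (1 + |(h z1).re|)) := by rw [hpow, mul_one]
    _ ≤ 4 * (cN * ((1 + |(h (I / 8)).re|) * Real.exp (cN * 4))) := by gcongr
    _ ≤ _ := by nlinarith [abs_nonneg (h (I / 8)).re]

lemma line_bound_unit : ∃ C : ℝ, 0 < C ∧ ∀ h : ℂ → ℂ, DifferentiableOn ℂ h (Metric.ball 0 1) →
    (∀ z ∈ Metric.ball (0 : ℂ) 1, z.im ≠ 0 → Complex.exp (h z) ≠ 1) →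
    ∀ z ∈ Metric.ball (0 : ℂ) (3 / 16),
      ‖deriv h z‖ ≤ C * (1 + |(h (I / 8)).re| + |(h (-(I / 8))).re|) := by
  obtain ⟨C, hC, hup⟩ := circle_upper
  refine ⟨C * 2 ^ (cN + 1) / (7 / 16) ^ (cN + 1), by positivity, ?_⟩
  intro h hh hom z hz
  set M := 1 + |(h (I / 8)).re| + |(h (-(I / 8))).re| with hM
  have hM0 : 0 < M := by positivity
  have hcirc : ∀ w : ℂ, ‖w‖ = 1 / 4 → ‖deriv h w‖ * (4 * |w.im|) ^ (cN + 1) ≤ C * M := by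
    intro w hw
    rcases lt_trichotomy w.im 0 with hi | hi | hi
    · have hneg : DifferentiableOn ℂ (fun z => h (-z)) (Metric.ball 0 1) := by
        refine hh.comp (differentiableOn_neg _) ?_
        intro v hv; simpa using hv
      have := hup (fun z => h (-z)) hneg (by
        intro v hv hvi
        exact hom (-v) (by simpa using hv) (by simpa using hvi)) (-w) (by simpa using hw)
        (by simpa using hi)
      rw [deriv_comp_neg (fun z => h z) (-w), neg_neg, norm_neg] at this
      rw [abs_of_neg hi]
      refine this.trans ?_
      gcongr
      simp only [hM]
      linarith [abs_nonneg (h (I / 8)).re]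
    · rw [hi]; simp; positivity
    · rw [abs_of_pos hi]
      refine (hup h hh hom w hw hi).trans ?_
      gcongr
      simp only [hM]
      linarith [abs_nonneg (h (-(I / 8))).re]
  have hh' : DifferentiableOn ℂ (deriv h) (Metric.ball 0 1) := hh.deriv Metric.isOpen_ball
  have hmax := Complex.norm_le_of_forall_mem_frontier_norm_le (U := Metric.ball (0 : ℂ) (1 / 4))
    Metric.isBounded_ball (f := fun w => deriv h w * (16 * w ^ 2 - 1) ^ (cN + 1))
    (C := C * 2 ^ (cN + 1) * M) (by
      refine DifferentiableOn.diffContOnCl ?_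
      rw [closure_ball _ (by norm_num)]
      refine (hh'.mono (Metric.closedBall_subset_ball (by norm_num))).mul ?_
      fun_prop) (by
      intro w hw
      rw [frontier_ball _ (by norm_num)] at hw
      have hw' : ‖w‖ = 1 / 4 := by simpa using hw
      have h16 : ‖16 * w ^ 2 - 1‖ = 2 * (4 * |w.im|) := by
        have hn : w.re ^ 2 + w.im ^ 2 = 1 / 16 := by
          have := Complex.sq_norm w
          rw [Complex.normSq_apply, hw'] at this; nlinarith
        have h1 : ‖16 * w ^ 2 - 1‖ ^ 2 = (2 * (4 * |w.im|)) ^ 2 := by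
          rw [Complex.sq_norm, Complex.normSq_apply]
          have hre : (16 * w ^ 2 - 1).re = 16 * (w.re ^ 2 - w.im ^ 2) - 1 := by
            simp [pow_two]
          have him : (16 * w ^ 2 - 1).im = 32 * (w.re * w.im) := by
            simp [pow_two]; ring
          rw [hre, him]
          have : (2 * (4 * |w.im|)) ^ 2 = 64 * w.im ^ 2 := by
            rw [mul_pow, mul_pow, sq_abs]; ring
          rw [this]
          have : w.re ^ 2 = 1 / 16 - w.im ^ 2 := by linarith
          ring_nf
          rw [show w.re ^ 4 = (w.re ^ 2) ^ 2 by ring, this]; ring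
        exact (pow_left_inj₀ (norm_nonneg _) (by positivity) two_ne_zero).mp h1
      rw [norm_mul, norm_pow, h16, mul_pow]
      have := hcirc w hw'
      calc _ = 2 ^ (cN + 1) * (‖deriv h w‖ * (4 * |w.im|) ^ (cN + 1)) := by ring
        _ ≤ 2 ^ (cN + 1) * (C * M) := by gcongr
        _ = _ := by ring) (z := z) (subset_closure (by
      rw [Metric.mem_ball] at hz ⊢; linarith))
  rw [norm_mul, norm_pow] at hmax
  have hz' : ‖z‖ < 3 / 16 := by simpa using hz
  have hlow : 7 / 16 ≤ ‖16 * z ^ 2 - 1‖ := by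
    have h1 : ‖(1 : ℂ)‖ ≤ ‖16 * z ^ 2 - 1‖ + ‖16 * z ^ 2‖ := by
      have : (1 : ℂ) = 16 * z ^ 2 - (16 * z ^ 2 - 1) := by ring
      conv_lhs => rw [this]
      rw [add_comm]; exact norm_sub_le _ _
    have h2 : ‖16 * z ^ 2‖ ≤ 9 / 16 := by
      rw [norm_mul, norm_pow]; simp; nlinarith [norm_nonneg z]
    rw [norm_one] at h1; linarith
  have hp : ‖deriv h z‖ * (7 / 16) ^ (cN + 1) ≤ C * 2 ^ (cN + 1) * M :=
    le_trans (by gcongr) hmax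
  rw [div_mul_eq_mul_div, le_div_iff₀ (by positivity)]
  exact hp

lemma line_bound (x : ℂ) {d : ℝ} (hd : 0 < d) : ∃ C : ℝ, 0 < C ∧ ∀ h : ℂ → ℂ,
    DifferentiableOn ℂ h (Metric.ball x d) →
    (∀ z ∈ Metric.ball x d, z.im ≠ x.im → Complex.exp (h z) ≠ 1) →
    ∀ z ∈ Metric.ball x (3 / 16 * d),
      ‖deriv h z‖ ≤ C * (1 + |(h (x + d * (I / 8))).re| + |(h (x + d * (-(I / 8)))).re|) := by
  obtain ⟨C, hC, hb⟩ := line_bound_unit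
  refine ⟨C / d, by positivity, ?_⟩
  intro h hh hom z hz
  have hd' : (d : ℂ) ≠ 0 := by exact_mod_cast hd.ne'
  have hmap : ∀ w ∈ Metric.ball (0 : ℂ) 1, x + d * w ∈ Metric.ball x d := by
    intro w hw
    rw [Metric.mem_ball, dist_zero_right] at hw
    rw [Metric.mem_ball, dist_eq_norm, add_sub_cancel_left, norm_mul, Complex.norm_real,
      Real.norm_of_nonneg hd.le]
    nlinarith
  set k : ℂ → ℂ := fun w => h (x + d * w) with hk
  set w : ℂ := (z - x) / d with hw
  have hzw : x + d * w = z := by rw [hw]; field_simp; ring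
  have hw1 : w ∈ Metric.ball (0 : ℂ) (3 / 16) := by
    rw [Metric.mem_ball, dist_eq_norm] at hz
    rw [Metric.mem_ball, dist_zero_right, hw, norm_div, Complex.norm_real,
      Real.norm_of_nonneg hd.le, div_lt_iff₀ hd]
    exact hz
  have h1 := hb k (hh.comp (by fun_prop) hmap) (by
    intro v hv hvi
    refine hom _ (hmap v hv) ?_
    simp [hd.ne', hvi]) w hw1
  have hzb : z ∈ Metric.ball x d := Metric.ball_subset_ball (by linarith) hz
  have h2 : deriv k w = deriv h z * d := by
    have h3 : HasDerivAt h (deriv h z) (x + d * w) := by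
      rw [hzw]; exact (hh.differentiableAt (Metric.isOpen_ball.mem_nhds hzb)).hasDerivAt
    have h4 : HasDerivAt (fun v : ℂ => x + d * v) d w := by
      simpa using ((hasDerivAt_id w).const_mul (d : ℂ)).const_add x
    exact (h3.comp w h4).deriv
  rw [h2, norm_mul, Complex.norm_real, Real.norm_of_nonneg hd.le] at h1
  rw [div_mul_eq_mul_div, le_div_iff₀ hd]
  exact h1

/-- Arzela–Ascoli for sequences on an open set. -/
lemma ascoli_seq {X : Type*} [MetricSpace X] [Nonempty X] {U : Set ℂ} (hU : IsOpen U)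
    (F : ℕ → ℂ → X)
    (hb : ∀ z ∈ U, ∃ K : Set X, IsCompact K ∧ ∀ k, F k z ∈ K)
    (he : ∀ z ∈ U, ∀ ε > (0 : ℝ), ∃ δ > 0, ∀ k, ∀ w ∈ U, dist w z < δ →
      dist (F k w) (F k z) ≤ ε) :
    ∃ φ : ℕ → ℕ, StrictMono φ ∧ ∃ g : ℂ → X,
      TendstoLocallyUniformlyOn (fun k => F (φ k)) g atTop U := by
  classical
  choose! Q hQ hFQ using hb
  choose! δ hδ hFδ using he
  have : LocallyCompactSpace U := hU.locallyCompactSpace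
  have hcont : ∀ f : U → X, (∀ z : U, ∀ ε > (0 : ℝ), ∀ w : U, dist (w : ℂ) z < δ z ε →
      dist (f w) (f z) ≤ ε) → Continuous f := by
    intro f hf
    rw [Metric.continuous_iff]
    intro z ε hε
    refine ⟨δ z (ε / 2), hδ z z.2 _ (by positivity), fun w hw => ?_⟩
    exact lt_of_le_of_lt (hf z (ε / 2) (by positivity) w hw) (by linarith)
  set S : Set C(U, X) := {f | (∀ z : U, f z ∈ Q z) ∧ ∀ z : U, ∀ ε > (0 : ℝ), ∀ w : U,
    dist (w : ℂ) z < δ z ε → dist (f w) (f z) ≤ ε} with hS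
  have himg : Set.image ContinuousMap.toFun S = {f : U → X | (∀ z : U, f z ∈ Q z) ∧
      ∀ z : U, ∀ ε > (0 : ℝ), ∀ w : U, dist (w : ℂ) z < δ z ε → dist (f w) (f z) ≤ ε} := by
    ext f
    constructor
    · rintro ⟨g, hg, rfl⟩; exact hg
    · intro hf; exact ⟨⟨f, hcont f hf.2⟩, hf, rfl⟩
  have hSc : IsCompact S := by
    apply ArzelaAscoli.isCompact_of_equicontinuous
    · rw [himg]
      refine IsCompact.of_isClosed_subset (isCompact_univ_pi fun z : U => hQ z z.2) ?_
        (fun f hf z _ => hf.1 z)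
      have h1 : {f : U → X | (∀ z : U, f z ∈ Q z) ∧
        ∀ z : U, ∀ ε > (0 : ℝ), ∀ w : U, dist (w : ℂ) z < δ z ε → dist (f w) (f z) ≤ ε} =
        (⋂ z : U, {f : U → X | f z ∈ Q z}) ∩ ⋂ (z : U), ⋂ (ε : ℝ), ⋂ (_ : ε > 0), ⋂ (w : U),
          ⋂ (_ : dist (w : ℂ) z < δ z ε), {f : U → X | dist (f w) (f z) ≤ ε} := by
        ext f; simp
      rw [h1]
      refine IsClosed.inter (isClosed_iInter fun z => ?_) (isClosed_iInter fun z =>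
        isClosed_iInter fun ε => isClosed_iInter fun hε => isClosed_iInter fun w =>
        isClosed_iInter fun hw => ?_)
      · exact (hQ z z.2).isClosed.preimage (continuous_apply z)
      · exact isClosed_le ((continuous_apply w).dist (continuous_apply z)) continuous_const
    · intro z
      rw [Metric.equicontinuousAt_iff]
      intro ε hε
      refine ⟨δ z (ε / 2), hδ z z.2 _ (by positivity), fun w hw f => ?_⟩
      rw [dist_comm]
      exact lt_of_le_of_lt (f.2.2 z (ε / 2) (by positivity) w hw) (by linarith)
  have hFc : ∀ k, Continuous (fun z : U => F k z) := fun k => hcont _ (fun z ε hε w hw =>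
    hFδ z z.2 ε hε k w w.2 hw)
  obtain ⟨g, -, φ, hφ, hlim⟩ := hSc.tendsto_subseq (x := fun k => (⟨_, hFc k⟩ : C(U, X)))
    (fun k => ⟨fun z => hFQ z z.2 k, fun z ε hε w hw => hFδ z z.2 ε hε k w w.2 hw⟩)
  refine ⟨φ, hφ, fun z => if hz : z ∈ U then g ⟨z, hz⟩ else Classical.arbitrary X, ?_⟩
  rw [tendstoLocallyUniformlyOn_iff_tendstoLocallyUniformly_comp_coe]
  have := ContinuousMap.tendsto_iff_tendstoLocallyUniformly.mp hlim
  have hg : (fun z => if hz : z ∈ U then g ⟨z, hz⟩ else Classical.arbitrary X) ∘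
      (Subtype.val : U → ℂ) = ⇑g := by
    funext z
    simp [z.2]
  rw [hg]
  exact this

/-- Montel-type lemma: locally bounded derivatives and a pointwise bound. -/
lemma montel_seq {U : Set ℂ} (hU : IsOpen U)
    (F : ℕ → ℂ → ℂ) (hF : ∀ k, DifferentiableOn ℂ (F k) U)
    (hb : ∀ z ∈ U, ∃ C : ℝ, ∀ k, ‖F k z‖ ≤ C)
    (hd : ∀ z ∈ U, ∃ ρ > 0, ∃ C : ℝ, ∀ k, ∀ w ∈ Metric.ball z ρ, ‖deriv (F k) w‖ ≤ C) :
    ∃ φ : ℕ → ℕ, StrictMono φ ∧ ∃ g : ℂ → ℂ, DifferentiableOn ℂ g U ∧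
      TendstoLocallyUniformlyOn (fun k => F (φ k)) g atTop U := by
  obtain ⟨φ, hφ, g, hg⟩ := ascoli_seq hU F
    (fun z hz => by
      obtain ⟨C, hC⟩ := hb z hz
      exact ⟨Metric.closedBall 0 C, isCompact_closedBall _ _, fun k => by simpa using hC k⟩)
    (fun z hz ε hε => by
      obtain ⟨ρ, hρ, C, hC⟩ := hd z hz
      obtain ⟨ρ', hρ', hball⟩ := Metric.isOpen_iff.mp hU z hz
      refine ⟨min (min ρ ρ') (ε / (|C| + 1)), by positivity, fun k w hw hwz => ?_⟩
      have h1 : dist w z < min ρ ρ' := lt_of_lt_of_le hwz (min_le_left _ _)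
      have h2 : dist w z < ε / (|C| + 1) := lt_of_lt_of_le hwz (min_le_right _ _)
      have hm : 0 < min ρ ρ' := by positivity
      have := (convex_ball z (min ρ ρ')).norm_image_sub_le_of_norm_deriv_le (𝕜 := ℂ)
        (f := F k) (C := |C| + 1)
        (x := z) (y := w) (fun v hv => (hF k).differentiableAt (hU.mem_nhds (hball
          (Metric.ball_subset_ball (min_le_right _ _) hv))))
        (fun v hv => (hC k v (Metric.ball_subset_ball (min_le_left _ _) hv)).trans
          (by linarith [le_abs_self C])) (Metric.mem_ball_self hm) h1
      rw [dist_eq_norm]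
      rw [lt_div_iff₀ (by positivity), dist_eq_norm] at h2
      linarith)
  exact ⟨φ, hφ, g, hg.differentiableOn (Eventually.of_forall fun k => hF _) hU, hg⟩

/-- Open rectangle. -/
def Rect (δ a b : ℝ) : Set ℂ := {z | |z.re| < δ ∧ a < z.im ∧ z.im < b}

/-- Midpoint on the imaginary axis. -/
def midp (a b : ℝ) : ℂ := ⟨0, (a + b) / 2⟩

lemma isOpen_Rect (δ a b : ℝ) : IsOpen (Rect δ a b) :=
  (isOpen_lt (f := fun z : ℂ => |z.re|) (by fun_prop) continuous_const).inter
    ((isOpen_lt (g := fun z : ℂ => z.im) continuous_const (by fun_prop)).inter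
      (isOpen_lt (f := fun z : ℂ => z.im) (by fun_prop) continuous_const))

lemma convex_Rect (δ a b : ℝ) : Convex ℝ (Rect δ a b) := by
  have h : Rect δ a b = Complex.reLm ⁻¹' (Ioo (-δ) δ) ∩ Complex.imLm ⁻¹' (Ioo a b) := by
    ext z; simp [Rect, abs_lt]
  rw [h]
  exact ((convex_Ioo _ _).linear_preimage _).inter ((convex_Ioo _ _).linear_preimage _)

lemma Rect_mono {δ a b a' b' : ℝ} (h1 : a ≤ a') (h2 : b' ≤ b) : Rect δ a' b' ⊆ Rect δ a b :=
  fun _ hz => ⟨hz.1, lt_of_le_of_lt h1 hz.2.1, lt_of_lt_of_le hz.2.2 h2⟩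

lemma midp_mem {δ a b : ℝ} (hδ : 0 < δ) (h : a < b) : midp a b ∈ Rect δ a b := by
  refine ⟨by simpa [midp] using hδ, ?_, ?_⟩ <;> simp only [midp] <;> linarith

/-- Logarithms of functions omitting one off a horizontal line. -/
structure LogF (δ a y b : ℝ) (h : ℂ → ℂ) : Prop where
  diff : DifferentiableOn ℂ h (Rect δ a b)
  ne : ∀ z ∈ Rect δ a b, z.im ≠ y → Complex.exp (h z) ≠ 1

/-- Size of a logarithm. -/
def Mag (a y b : ℝ) (h : ℂ → ℂ) : ℝ := 1 + |(h (midp a y)).re| + |(h (midp y b)).re|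

lemma Mag_ge_one (a y b : ℝ) (h : ℂ → ℂ) : 1 ≤ Mag a y b h := by
  unfold Mag; linarith [abs_nonneg (h (midp a y)).re, abs_nonneg (h (midp y b)).re]

lemma growth_convex {U : Set ℂ} (hU : Convex ℝ U) (hUo : IsOpen U) {w z : ℂ} (hw : w ∈ U)
    (hz : z ∈ U) : ∃ C : ℝ, 0 < C ∧ ∀ h : ℂ → ℂ, DifferentiableOn ℂ h U →
      (∀ z ∈ U, Complex.exp (h z) ≠ 1) → ∀ v ∈ segment ℝ w z,
      1 + |(h v).re| ≤ C * (1 + |(h w).re|) ∧ 1 + |(h w).re| ≤ C * (1 + |(h v).re|) := by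
  have hK : IsCompact (segment ℝ w z) := by
    rw [segment_eq_image']
    exact isCompact_Icc.image (by fun_prop)
  obtain ⟨ρ, hρ, hsub⟩ := hK.exists_thickening_subset_open hUo (hU.segment_subset hw hz)
  refine ⟨Real.exp (cN * (‖z - w‖ / ρ + 1)), Real.exp_pos _, fun h hh hom v hv => ?_⟩
  have hnorm : ‖v - w‖ ≤ ‖z - w‖ := by
    rw [segment_eq_image'] at hv
    obtain ⟨t, ht, rfl⟩ := hv
    simp only [add_sub_cancel_left, norm_smul, Real.norm_of_nonneg ht.1]
    nlinarith [norm_nonneg (z - w), ht.2]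
  have hvs : segment ℝ w v ⊆ segment ℝ w z :=
    (convex_segment w z).segment_subset (left_mem_segment _ _ _) hv
  have hball : ∀ c ∈ segment ℝ w z, Metric.ball c ρ ⊆ U := fun c hc =>
    (Metric.ball_subset_thickening hc ρ).trans hsub
  have hexp : Real.exp (cN * (‖v - w‖ / ρ + 1)) ≤ Real.exp (cN * (‖z - w‖ / ρ + 1)) := by
    gcongr
  constructor
  · have := growth_seg hρ (fun c hc => hball c (hvs hc)) hh hom
    rw [mul_comm]
    exact this.trans (by gcongr)
  · have := growth_seg hρ (a := v) (b := w) (fun c hc => hball c (hvs (by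
      rwa [segment_symm] at hc))) hh hom
    rw [mul_comm]
    rw [norm_sub_rev] at this
    exact this.trans (by gcongr)

/-- Local derivative bound in a convex region where one is omitted. -/
lemma core_convex {U : Set ℂ} (hU : Convex ℝ U) (hUo : IsOpen U) {w z : ℂ} (hw : w ∈ U)
    (hz : z ∈ U) : ∃ ρ > 0, ∃ C : ℝ, 0 < C ∧ ∀ h : ℂ → ℂ, DifferentiableOn ℂ h U →
      (∀ z ∈ U, Complex.exp (h z) ≠ 1) → ∀ v ∈ Metric.ball z ρ,
      ‖deriv h v‖ ≤ C * (1 + |(h w).re|) := by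
  obtain ⟨C, hC, hgr⟩ := growth_convex hU hUo hw hz
  obtain ⟨r, hr, hball⟩ := Metric.isOpen_iff.mp hUo z hz
  refine ⟨r / 2, by positivity, (cN * (Real.exp (cN * 2) * C) + 1) / (r / 2), by positivity, ?_⟩
  intro h hh hom v hv
  have hsub : ∀ c ∈ Metric.ball z (r / 2), Metric.ball c (r / 2) ⊆ U := by
    intro c hc x hx
    apply hball
    rw [Metric.mem_ball] at *
    linarith [dist_triangle x c z]
  have h1 := core (half_pos hr) (hh.mono (hsub v hv)) (fun x hx => hom x (hsub v hv hx))
  have h2 := growth_seg (a := z) (b := v) (half_pos hr) (fun c hc => hsub c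
    ((convex_ball z (r / 2)).segment_subset (Metric.mem_ball_self (half_pos hr)) hv hc)) hh hom
  have h3 := (hgr h hh hom z (right_mem_segment _ _ _)).1
  have h4 : ‖v - z‖ / (r / 2) + 1 ≤ 2 := by
    have : ‖v - z‖ / (r / 2) ≤ 1 := by
      rw [div_le_one (half_pos hr)]; rw [Metric.mem_ball, dist_eq_norm] at hv; exact hv.le
    linarith
  rw [div_mul_eq_mul_div, le_div_iff₀ (half_pos hr)]
  calc _ ≤ _ := h1
    _ ≤ cN * ((1 + |(h z).re|) * Real.exp (cN * 2)) := by
      gcongr; exact h2.trans (by gcongr)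
    _ ≤ cN * ((C * (1 + |(h w).re|)) * Real.exp (cN * 2)) := by gcongr
    _ ≤ _ := by nlinarith [abs_nonneg (h w).re]

section
variable {δ a y b : ℝ}

lemma LogF.lower {h : ℂ → ℂ} (hh : LogF δ a y b h) (hyb : y < b) :
    DifferentiableOn ℂ h (Rect δ a y) ∧ ∀ z ∈ Rect δ a y, Complex.exp (h z) ≠ 1 :=
  ⟨hh.diff.mono (Rect_mono le_rfl hyb.le), fun z hz => hh.ne z (Rect_mono le_rfl hyb.le hz)
    hz.2.2.ne⟩

lemma LogF.upper {h : ℂ → ℂ} (hh : LogF δ a y b h) (hay : a < y) :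
    DifferentiableOn ℂ h (Rect δ y b) ∧ ∀ z ∈ Rect δ y b, Complex.exp (h z) ≠ 1 :=
  ⟨hh.diff.mono (Rect_mono hay.le le_rfl), fun z hz => hh.ne z (Rect_mono hay.le le_rfl hz)
    hz.2.1.ne'⟩

/-- Two-sided comparison with the size at the base point. -/
lemma rect_pt (hδ : 0 < δ) (hay : a < y) (hyb : y < b) {z : ℂ} (hz : z ∈ Rect δ a b)
    (hzy : z.im ≠ y) : ∃ C : ℝ, 0 < C ∧ ∀ h : ℂ → ℂ, LogF δ a y b h →
      1 + |(h z).re| ≤ C * Mag a y b h := by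
  rcases lt_or_gt_of_ne hzy with hlt | hgt
  · obtain ⟨C, hC, hb⟩ := growth_convex (convex_Rect δ a y) (isOpen_Rect δ a y)
      (midp_mem hδ hay) (z := z) ⟨hz.1, hz.2.1, hlt⟩
    refine ⟨C, hC, fun h hh => ?_⟩
    refine (hb h (hh.lower hyb).1 (hh.lower hyb).2 z (right_mem_segment _ _ _)).1.trans ?_
    refine mul_le_mul_of_nonneg_left ?_ hC.le; unfold Mag; linarith [abs_nonneg (h (midp y b)).re]
  · obtain ⟨C, hC, hb⟩ := growth_convex (convex_Rect δ y b) (isOpen_Rect δ y b)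
      (midp_mem hδ hyb) (z := z) ⟨hz.1, hgt, hz.2.2⟩
    refine ⟨C, hC, fun h hh => ?_⟩
    refine (hb h (hh.upper hay).1 (hh.upper hay).2 z (right_mem_segment _ _ _)).1.trans ?_
    refine mul_le_mul_of_nonneg_left ?_ hC.le; unfold Mag; linarith [abs_nonneg (h (midp a y)).re]

/-- Local derivative bound. -/
lemma rect_deriv (hδ : 0 < δ) (hay : a < y) (hyb : y < b) {z : ℂ} (hz : z ∈ Rect δ a b) :
    ∃ ρ > 0, ∃ C : ℝ, 0 < C ∧ ∀ h : ℂ → ℂ, LogF δ a y b h → ∀ v ∈ Metric.ball z ρ,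
      ‖deriv h v‖ ≤ C * Mag a y b h := by
  rcases lt_trichotomy z.im y with hlt | heq | hgt
  · obtain ⟨ρ, hρ, C, hC, hb⟩ := core_convex (convex_Rect δ a y) (isOpen_Rect δ a y)
      (midp_mem hδ hay) (z := z) ⟨hz.1, hz.2.1, hlt⟩
    refine ⟨ρ, hρ, C, hC, fun h hh v hv => ?_⟩
    refine (hb h (hh.lower hyb).1 (hh.lower hyb).2 v hv).trans ?_
    refine mul_le_mul_of_nonneg_left ?_ hC.le; unfold Mag; linarith [abs_nonneg (h (midp y b)).re]
  · obtain ⟨d, hd, hball⟩ := Metric.isOpen_iff.mp (isOpen_Rect δ a b) z hz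
    obtain ⟨C, hC, hb⟩ := line_bound z hd
    have hmem : ∀ s : ℂ, ‖s‖ = 1 / 8 → z + d * s ∈ Rect δ a b := by
      intro s hs
      apply hball
      rw [Metric.mem_ball, dist_eq_norm, add_sub_cancel_left, norm_mul, hs, Complex.norm_real,
        Real.norm_of_nonneg hd.le]
      linarith
    have h1 := hmem (I / 8) (by simp)
    have h2 := hmem (-(I / 8)) (by simp)
    obtain ⟨C1, hC1, hb1⟩ := rect_pt hδ hay hyb h1 (by simp [heq, hd.ne'])
    obtain ⟨C2, hC2, hb2⟩ := rect_pt hδ hay hyb h2 (by simp [heq, hd.ne'])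
    refine ⟨3 / 16 * d, by positivity, C * (C1 + C2), by positivity, fun h hh v hv => ?_⟩
    refine (hb h (hh.diff.mono hball) (fun w hw hwi => hh.ne w (hball hw) (heq ▸ hwi)) v
      hv).trans ?_
    rw [mul_assoc]
    gcongr
    linarith [hb1 h hh, hb2 h hh]
  · obtain ⟨ρ, hρ, C, hC, hb⟩ := core_convex (convex_Rect δ y b) (isOpen_Rect δ y b)
      (midp_mem hδ hyb) (z := z) ⟨hz.1, hgt, hz.2.2⟩
    refine ⟨ρ, hρ, C, hC, fun h hh v hv => ?_⟩
    refine (hb h (hh.upper hay).1 (hh.upper hay).2 v hv).trans ?_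
    refine mul_le_mul_of_nonneg_left ?_ hC.le; unfold Mag; linarith [abs_nonneg (h (midp a y)).re]

/-- Derivative bound on compact sets. -/
lemma rect_deriv_compact (hδ : 0 < δ) (hay : a < y) (hyb : y < b) {K : Set ℂ}
    (hK : IsCompact K) (hKQ : K ⊆ Rect δ a b) :
    ∃ C : ℝ, 0 < C ∧ ∀ h : ℂ → ℂ, LogF δ a y b h → ∀ v ∈ K,
      ‖deriv h v‖ ≤ C * Mag a y b h := by
  refine hK.induction_on (p := fun S => ∃ C : ℝ, 0 < C ∧ ∀ h : ℂ → ℂ, LogF δ a y b h → ∀ v ∈ S,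
      ‖deriv h v‖ ≤ C * Mag a y b h) ⟨1, one_pos, by simp⟩ ?_ ?_ ?_
  · rintro s t hst ⟨C, hC, hb⟩
    exact ⟨C, hC, fun h hh v hv => hb h hh v (hst hv)⟩
  · rintro s t ⟨C, hC, hb⟩ ⟨C', hC', hb'⟩
    refine ⟨C + C', by positivity, ?_⟩
    intro h hh v hv
    have hm := Mag_ge_one a y b h
    rcases hv with hv | hv
    · nlinarith [hb h hh v hv]
    · nlinarith [hb' h hh v hv]
  · intro z hz
    obtain ⟨ρ, hρ, C, hC, hb⟩ := rect_deriv hδ hay hyb (hKQ hz)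
    exact ⟨Metric.ball z ρ, mem_nhdsWithin_of_mem_nhds (Metric.ball_mem_nhds z hρ), C, hC, hb⟩

/-- Bound on differences of values. -/
lemma rect_diff (hδ : 0 < δ) (hay : a < y) (hyb : y < b) {w z : ℂ} (hw : w ∈ Rect δ a b)
    (hz : z ∈ Rect δ a b) :
    ∃ C : ℝ, 0 < C ∧ ∀ h : ℂ → ℂ, LogF δ a y b h → ‖h z - h w‖ ≤ C * Mag a y b h := by
  have hK : IsCompact (segment ℝ w z) := by
    rw [segment_eq_image']
    exact isCompact_Icc.image (by fun_prop)
  have hsub := (convex_Rect δ a b).segment_subset hw hz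
  obtain ⟨C, hC, hb⟩ := rect_deriv_compact hδ hay hyb hK hsub
  refine ⟨C * (‖z - w‖ + 1), by positivity, fun h hh => ?_⟩
  have := (convex_segment w z).norm_image_sub_le_of_norm_deriv_le (𝕜 := ℂ)
    (f := h) (fun v hv => hh.diff.differentiableAt ((isOpen_Rect δ a b).mem_nhds (hsub hv)))
    (fun v hv => hb h hh v hv) (left_mem_segment _ _ _) (right_mem_segment _ _ _)
  have hm := Mag_ge_one a y b h
  refine this.trans ?_
  have : 0 ≤ C * Mag a y b h := by positivity
  nlinarith

/-- Montel for scaled and shifted logarithms. -/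
lemma rect_montel (hδ : 0 < δ) (hay : a < y) (hyb : y < b) (h : ℕ → ℂ → ℂ)
    (hh : ∀ k, LogF δ a y b (h k)) (s c : ℕ → ℝ) (B : ℝ) (hs0 : ∀ k, 0 ≤ s k)
    (hs : ∀ k, s k * Mag a y b (h k) ≤ B)
    (hc : ∀ k, |s k * (h k (midp y b)).im - c k| ≤ B) :
    ∃ φ : ℕ → ℕ, StrictMono φ ∧ ∃ H : ℂ → ℂ, DifferentiableOn ℂ H (Rect δ a b) ∧
      TendstoLocallyUniformlyOn (fun k z => (s (φ k) : ℂ) * h (φ k) z - c (φ k) * I) H atTop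
        (Rect δ a b) := by
  have hm : midp y b ∈ Rect δ a b := Rect_mono hay.le le_rfl (midp_mem hδ hyb)
  refine montel_seq (isOpen_Rect δ a b) (fun k z => (s k : ℂ) * h k z - c k * I)
    (fun k => ((hh k).diff.const_mul _).sub_const _) ?_ ?_
  · intro z hz
    obtain ⟨C, hC, hb⟩ := rect_diff hδ hay hyb hm hz
    refine ⟨C * B + (B + B), fun k => ?_⟩
    have h1 : (s k : ℂ) * h k z - c k * I = s k * (h k z - h k (midp y b)) +
        (s k * h k (midp y b) - c k * I) := by ring
    rw [h1]
    refine (norm_add_le _ _).trans (add_le_add ?_ ?_)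
    · rw [norm_mul, Complex.norm_real, Real.norm_of_nonneg (hs0 k)]
      calc _ ≤ s k * (C * Mag a y b (h k)) :=
            mul_le_mul_of_nonneg_left (hb _ (hh k)) (hs0 k)
        _ = C * (s k * Mag a y b (h k)) := by ring
        _ ≤ _ := mul_le_mul_of_nonneg_left (hs k) hC.le
    · refine (Complex.norm_le_abs_re_add_abs_im _).trans (add_le_add ?_ ?_)
      · have : ((s k : ℂ) * h k (midp y b) - c k * I).re = s k * (h k (midp y b)).re := by simp
        rw [this, abs_mul, abs_of_nonneg (hs0 k)]
        refine le_trans (mul_le_mul_of_nonneg_left ?_ (hs0 k)) (hs k)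
        unfold Mag; linarith [abs_nonneg (h k (midp a y)).re]
      · have : ((s k : ℂ) * h k (midp y b) - c k * I).im =
          s k * (h k (midp y b)).im - c k := by simp
        rw [this]; exact hc k
  · intro z hz
    obtain ⟨ρ, hρ, C, hC, hb⟩ := rect_deriv hδ hay hyb hz
    refine ⟨ρ, hρ, C * B, fun k w hw => ?_⟩
    rw [deriv_sub_const, deriv_const_mul_field, norm_mul, Complex.norm_real,
      Real.norm_of_nonneg (hs0 k)]
    calc _ ≤ s k * (C * Mag a y b (h k)) :=
          mul_le_mul_of_nonneg_left (hb _ (hh k) w hw) (hs0 k)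
      _ = C * (s k * Mag a y b (h k)) := by ring
      _ ≤ _ := mul_le_mul_of_nonneg_left (hs k) hC.le

end

lemma const_sign {S : Set ℂ} (hS : IsPreconnected S) (hne : S.Nonempty) {g : ℂ → ℝ}
    (hg : ContinuousOn g S) (h0 : ∀ z ∈ S, g z ≠ 0) :
    ∃ σ : ℝ, (σ = 1 ∨ σ = -1) ∧ ∀ z ∈ S, 0 < σ * g z := by
  obtain ⟨w, hw⟩ := hne
  rcases lt_or_gt_of_ne (h0 w hw) with h | h
  · refine ⟨-1, Or.inr rfl, fun z hz => ?_⟩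
    by_contra hcon
    have hz0 : 0 ≤ g z := by linarith
    obtain ⟨v, hv, hv0⟩ := hS.intermediate_value hw hz hg ⟨h.le, hz0⟩
    exact h0 v hv hv0
  · refine ⟨1, Or.inl rfl, fun z hz => ?_⟩
    by_contra hcon
    have hz0 : g z ≤ 0 := by linarith
    obtain ⟨v, hv, hv0⟩ := hS.intermediate_value hz hw hg ⟨hz0, h.le⟩
    exact h0 v hv hv0

lemma re_zero_of_subset {U V : Set ℂ} (hU : IsOpen U) (hUc : IsPreconnected U) (hV : IsOpen V)
    (hVc : IsConnected V) (hVU : V ⊆ U) {H : ℂ → ℂ} (hH : DifferentiableOn ℂ H U)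
    (h0 : ∀ z ∈ V, (H z).re = 0) : ∀ z ∈ U, (H z).re = 0 := by
  have hA : AnalyticOnNhd ℂ H U := hH.analyticOnNhd hU
  obtain ⟨c, hc⟩ := (hA.mono hVU).eq_const_of_re_eq_const h0 hV hVc
  obtain ⟨w, hw⟩ := hVc.nonempty
  have := hA.eqOn_of_preconnected_of_eventuallyEq (g := fun _ => c) analyticOnNhd_const hUc
    (hVU hw) (by filter_upwards [hV.mem_nhds hw] with z hz using hc z hz)
  intro z hz
  rw [this hz]
  simpa [hc w hw] using h0 w hw

lemma isConnected_Rect {δ a b : ℝ} (hδ : 0 < δ) (h : a < b) : IsConnected (Rect δ a b) :=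
  ⟨⟨_, midp_mem hδ h⟩, (convex_Rect δ a b).isPreconnected⟩

section
variable {δ a y b : ℝ}

/-- Limits of normalized logarithms. -/
lemma rect_big (hδ : 0 < δ) (hay : a < y) (hyb : y < b) (h : ℕ → ℂ → ℂ)
    (hh : ∀ k, LogF δ a y b (h k))
    (hM : Tendsto (fun k => Mag a y b (h k)) atTop atTop) :
    ∃ φ : ℕ → ℕ, StrictMono φ ∧ ∃ H : ℂ → ℂ, DifferentiableOn ℂ H (Rect δ a b) ∧
      (∀ z ∈ Rect δ a b, ∀ w : ℕ → ℂ, Tendsto w atTop (𝓝 z) →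
        Tendsto (fun k => (h (φ k) (w k)).re / Mag a y b (h (φ k))) atTop (𝓝 (H z).re)) ∧
      ∃ σ₁ σ₂ : ℝ, (σ₁ = 1 ∨ σ₁ = -1) ∧ (σ₂ = 1 ∨ σ₂ = -1) ∧
        (∀ z ∈ Rect δ a y, 0 < σ₁ * (H z).re) ∧ (∀ z ∈ Rect δ y b, 0 < σ₂ * (H z).re) := by
  have hM1 : ∀ k, 0 < Mag a y b (h k) := fun k => lt_of_lt_of_le one_pos (Mag_ge_one _ _ _ _)
  obtain ⟨φ, hφ, H, hHd, hlim⟩ := rect_montel hδ hay hyb h hh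
    (fun k => (Mag a y b (h k))⁻¹) (fun k => (Mag a y b (h k))⁻¹ * (h k (midp y b)).im) 1
    (fun k => (inv_pos.mpr (hM1 k)).le) (fun k => by rw [inv_mul_cancel₀ (hM1 k).ne'])
    (fun k => by simp)
  have hMφ : Tendsto (fun k => Mag a y b (h (φ k))) atTop atTop := hM.comp hφ.tendsto_atTop
  have hseq : ∀ z ∈ Rect δ a b, ∀ w : ℕ → ℂ, Tendsto w atTop (𝓝 z) →
        Tendsto (fun k => (h (φ k) (w k)).re / Mag a y b (h (φ k))) atTop (𝓝 (H z).re) := by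
    intro z hz w hw
    have hw' : Tendsto w atTop (𝓝[Rect δ a b] z) := by
      rwa [(isOpen_Rect δ a b).nhdsWithin_eq hz]
    have := hlim.tendsto_comp (hHd.continuousOn z hz) hz hw'
    have h2 := (Complex.continuous_re.tendsto _).comp this
    refine h2.congr fun k => ?_
    simp only [Function.comp_apply, Complex.sub_re, Complex.re_ofReal_mul]
    simp [div_eq_inv_mul]
  have hpt : ∀ z ∈ Rect δ a b,
      Tendsto (fun k => (h (φ k) z).re / Mag a y b (h (φ k))) atTop (𝓝 (H z).re) :=
    fun z hz => hseq z hz (fun _ => z) tendsto_const_nhds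
  have hm1 : midp a y ∈ Rect δ a y := midp_mem hδ hay
  have hm2 : midp y b ∈ Rect δ y b := midp_mem hδ hyb
  have hs1 : Rect δ a y ⊆ Rect δ a b := Rect_mono le_rfl hyb.le
  have hs2 : Rect δ y b ⊆ Rect δ a b := Rect_mono hay.le le_rfl
  have hinv : Tendsto (fun k => (Mag a y b (h (φ k)))⁻¹) atTop (𝓝 0) :=
    tendsto_inv_atTop_zero.comp hMφ
  have hsum : |(H (midp a y)).re| + |(H (midp y b)).re| = 1 := by
    have h1 := (hinv.add (hpt _ (hs1 hm1)).abs).add (hpt _ (hs2 hm2)).abs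
    have h2 : Tendsto (fun _ : ℕ => (1 : ℝ)) atTop
        (𝓝 (0 + |(H (midp a y)).re| + |(H (midp y b)).re|)) := by
      refine h1.congr fun k => ?_
      have hp := hM1 (φ k)
      rw [abs_div, abs_div, abs_of_pos hp]
      field_simp
      unfold Mag; ring
    have := tendsto_nhds_unique h2 tendsto_const_nhds
    linarith
  have hcmp : ∀ V : Set ℂ, Convex ℝ V → IsOpen V → V ⊆ Rect δ a b →
      (∀ k, ∀ z ∈ V, Complex.exp (h k z) ≠ 1) → ∀ z ∈ V, ∀ w ∈ V, (H z).re = 0 →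
      (H w).re = 0 := by
    intro V hV hVo hVQ hVne z hz w hw h0
    obtain ⟨C, hC, hb⟩ := growth_convex hV hVo hz hw
    have h1 : ∀ k, (Mag a y b (h (φ k)))⁻¹ + |(h (φ k) w).re / Mag a y b (h (φ k))| ≤
        C * ((Mag a y b (h (φ k)))⁻¹ + |(h (φ k) z).re / Mag a y b (h (φ k))|) := by
      intro k
      have hp := hM1 (φ k)
      have := (hb (h (φ k)) ((hh _).diff.mono hVQ) (hVne _) w (right_mem_segment _ _ _)).1
      rw [abs_div, abs_div, abs_of_pos hp, inv_eq_one_div, ← add_div, ← add_div, ← mul_div_assoc]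
      gcongr
    have h2 := le_of_tendsto_of_tendsto' (hinv.add (hpt _ (hVQ hw)).abs)
      ((hinv.add (hpt _ (hVQ hz)).abs).const_mul C) h1
    rw [h0] at h2
    simpa using h2
  have hQ := convex_Rect δ a b
  have hno : ∀ V : Set ℂ, Convex ℝ V → IsOpen V → V ⊆ Rect δ a b →
      (∀ k, ∀ z ∈ V, Complex.exp (h k z) ≠ 1) → ∀ z ∈ V, (H z).re ≠ 0 := by
    intro V hV hVo hVQ hVne z hz h0
    have := re_zero_of_subset (isOpen_Rect δ a b) hQ.isPreconnected hVo
      ⟨⟨z, hz⟩, hV.isPreconnected⟩ hVQ hHd (fun w hw => hcmp V hV hVo hVQ hVne z hz w hw h0)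
    rw [this _ (hs1 hm1), this _ (hs2 hm2)] at hsum
    simp at hsum
  have hcont : ContinuousOn (fun z => (H z).re) (Rect δ a b) :=
    Complex.continuous_re.comp_continuousOn hHd.continuousOn
  obtain ⟨σ₁, hσ₁, hp1⟩ := const_sign (convex_Rect δ a y).isPreconnected ⟨_, hm1⟩
    (hcont.mono hs1) (hno _ (convex_Rect δ a y) (isOpen_Rect δ a y) hs1
      (fun k => ((hh k).lower hyb).2))
  obtain ⟨σ₂, hσ₂, hp2⟩ := const_sign (convex_Rect δ y b).isPreconnected ⟨_, hm2⟩
    (hcont.mono hs2) (hno _ (convex_Rect δ y b) (isOpen_Rect δ y b) hs2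
      (fun k => ((hh k).upper hay).2))
  exact ⟨φ, hφ, H, hHd, hseq, σ₁, σ₂, hσ₁, hσ₂, hp1, hp2⟩

/-- Limits in the bounded case. -/
lemma rect_small (hδ : 0 < δ) (hay : a < y) (hyb : y < b) (h : ℕ → ℂ → ℂ)
    (hh : ∀ k, LogF δ a y b (h k)) (B : ℝ) (hM : ∀ k, Mag a y b (h k) ≤ B) :
    ∃ φ : ℕ → ℕ, StrictMono φ ∧ ∃ H : ℂ → ℂ, DifferentiableOn ℂ H (Rect δ a b) ∧
      (∀ z ∈ Rect δ a b, ∀ w : ℕ → ℂ, Tendsto w atTop (𝓝 z) →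
        Tendsto (fun k => Complex.exp (h (φ k) (w k))) atTop (𝓝 (Complex.exp (H z)))) := by
  obtain ⟨φ, hφ, H, hHd, hlim⟩ := rect_montel hδ hay hyb h hh
    (fun k => 1) (fun k => 2 * Real.pi * round ((h k (midp y b)).im / (2 * Real.pi)))
    (max B (2 * Real.pi)) (fun k => zero_le_one)
    (fun k => by rw [one_mul]; exact (hM k).trans (le_max_left _ _))
    (fun k => by
      refine le_trans ?_ (le_max_right _ _)
      have h1 := abs_sub_round ((h k (midp y b)).im / (2 * Real.pi))
      have hpi : 0 < 2 * Real.pi := by positivity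
      have h2 : 1 * (h k (midp y b)).im - 2 * Real.pi *
          round ((h k (midp y b)).im / (2 * Real.pi)) = 2 * Real.pi *
          ((h k (midp y b)).im / (2 * Real.pi) - round ((h k (midp y b)).im / (2 * Real.pi))) := by
        field_simp
      rw [h2, abs_mul, abs_of_pos hpi]
      nlinarith)
  refine ⟨φ, hφ, H, hHd, fun z hz w hw => ?_⟩
  have hw' : Tendsto w atTop (𝓝[Rect δ a b] z) := by
    rwa [(isOpen_Rect δ a b).nhdsWithin_eq hz]
  have := hlim.tendsto_comp (hHd.continuousOn z hz) hz hw'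
  have h2 := (Complex.continuous_exp.tendsto _).comp this
  refine h2.congr fun k => ?_
  simp only [Function.comp_apply]
  rw [Complex.exp_eq_exp_iff_exists_int]
  refine ⟨-round ((h (φ k) (midp y b)).im / (2 * Real.pi)), ?_⟩
  push_cast
  ring

lemma mag_cases (h : ℕ → ℂ → ℂ) : ∃ φ : ℕ → ℕ, StrictMono φ ∧
    (Tendsto (fun k => Mag a y b (h (φ k))) atTop atTop ∨ ∃ B, ∀ k, Mag a y b (h (φ k)) ≤ B) := by
  by_cases hM : Tendsto (fun k => Mag a y b (h k)) atTop atTop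
  · exact ⟨id, strictMono_id, Or.inl hM⟩
  · rw [tendsto_atTop] at hM
    push Not at hM
    obtain ⟨B, hB⟩ := hM
    obtain ⟨φ, hφ, hb⟩ := extraction_of_frequently_atTop hB
    exact ⟨φ, hφ, Or.inr ⟨B, fun k => (hb k).le⟩⟩

/-- Convergence to one crosses the line. -/
lemma rect_one (hδ : 0 < δ) (hay : a < y) (hyb : y < b) (h : ℕ → ℂ → ℂ)
    (hh : ∀ k, LogF δ a y b (h k)) {V : Set ℂ} (hV : IsOpen V) (hVne : V.Nonempty)
    (hVQ : V ⊆ Rect δ a b) (hVy : ∀ z ∈ V, z.im ≠ y)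
    (h1 : ∀ z ∈ V, Tendsto (fun k => Complex.exp (h k z)) atTop (𝓝 1)) :
    ∃ φ : ℕ → ℕ, StrictMono φ ∧ ∀ z ∈ Rect δ a b,
      Tendsto (fun k => Complex.exp (h (φ k) z)) atTop (𝓝 1) := by
  obtain ⟨z, hz⟩ := hVne
  obtain ⟨φ, hφ, hc⟩ := mag_cases (a := a) (y := y) (b := b) h
  rcases hc with hM | ⟨B, hB⟩
  · exfalso
    obtain ⟨ψ, hψ, H, hHd, hseq, σ₁, σ₂, hσ₁, hσ₂, hp1, hp2⟩ :=
      rect_big hδ hay hyb (fun k => h (φ k)) (fun k => hh _) hM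
    have hlim := hseq z (hVQ hz) (fun _ => z) tendsto_const_nhds
    have hu : Tendsto (fun k => (h (φ (ψ k)) z).re) atTop (𝓝 0) := by
      have h2 := ((h1 z hz).comp (hφ.comp hψ).tendsto_atTop).norm
      have h3 := (Real.continuousAt_log (x := ‖(1 : ℂ)‖) (by simp)).tendsto.comp h2
      simp only [norm_one, Real.log_one] at h3
      refine h3.congr fun k => ?_
      simp [Complex.norm_exp]
    have hinv : Tendsto (fun k => (Mag a y b (h (φ (ψ k))))⁻¹) atTop (𝓝 0) :=
      tendsto_inv_atTop_zero.comp (hM.comp hψ.tendsto_atTop)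
    have h0 : (H z).re = 0 := by
      refine tendsto_nhds_unique hlim ?_
      simpa [div_eq_mul_inv] using hu.mul hinv
    rcases lt_or_gt_of_ne (hVy z hz) with hlt | hgt
    · have := hp1 z ⟨(hVQ hz).1, (hVQ hz).2.1, hlt⟩
      simp [h0] at this
    · have := hp2 z ⟨(hVQ hz).1, hgt, (hVQ hz).2.2⟩
      simp [h0] at this
  · obtain ⟨ψ, hψ, H, hHd, hseq⟩ :=
      rect_small hδ hay hyb (fun k => h (φ k)) (fun k => hh _) B hB
    refine ⟨fun k => φ (ψ k), hφ.comp hψ, ?_⟩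
    have hV1 : ∀ w ∈ V, Complex.exp (H w) = 1 := fun w hw =>
      tendsto_nhds_unique (hseq w (hVQ hw) (fun _ => w) tendsto_const_nhds)
        ((h1 w hw).comp (hφ.comp hψ).tendsto_atTop)
    have hE : AnalyticOnNhd ℂ (fun z => Complex.exp (H z)) (Rect δ a b) :=
      (hHd.cexp).analyticOnNhd (isOpen_Rect δ a b)
    have := hE.eqOn_of_preconnected_of_eventuallyEq (g := fun _ => 1) analyticOnNhd_const
      (convex_Rect δ a b).isPreconnected (hVQ hz)
      (by filter_upwards [hV.mem_nhds hz] with w hw using hV1 w hw)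
    intro w hw
    have h3 := hseq w hw (fun _ => w) tendsto_const_nhds
    have h4 : Complex.exp (H w) = 1 := this hw
    rwa [h4] at h3

/-- Same signs propagate to the line. -/
lemma same_sign {H : ℂ → ℂ}
    (hH : DifferentiableOn ℂ H (Rect δ a b)) {σ : ℝ}
    (h1 : ∀ z ∈ Rect δ a y, 0 < σ * (H z).re) (h2 : ∀ z ∈ Rect δ y b, 0 < σ * (H z).re) :
    ∀ z ∈ Rect δ a b, 0 < σ * (H z).re := by
  intro z hz
  have hoff : ∀ w ∈ Rect δ a b, w.im ≠ y → 0 < σ * (H w).re := by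
    intro w hw hwy
    rcases lt_or_gt_of_ne hwy with hlt | hgt
    · exact h1 w ⟨hw.1, hw.2.1, hlt⟩
    · exact h2 w ⟨hw.1, hgt, hw.2.2⟩
  by_cases hzy : z.im = y
  swap
  · exact hoff z hz hzy
  have hQn : Rect δ a b ∈ 𝓝 z := (isOpen_Rect δ a b).mem_nhds hz
  have hcont : ContinuousAt (fun z => σ * (H z).re) z := by
    have := (hH.continuousOn).continuousAt hQn
    exact continuousAt_const.mul (Complex.continuous_re.continuousAt.comp this)
  have happ : ∀ w ∈ Rect δ a b, w.im = y →
      Tendsto (fun t : ℝ => w + t * I) (𝓝[>] 0) (𝓝 w) ∧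
      ∀ᶠ t : ℝ in 𝓝[>] 0, w + t * I ∈ Rect δ a b ∧ (w + t * I).im ≠ y := by
    intro w hw hwy
    have ht : Tendsto (fun t : ℝ => w + t * I) (𝓝[>] 0) (𝓝 w) := by
      have : Continuous (fun t : ℝ => w + t * I) := by fun_prop
      have := this.tendsto 0
      simp only [Complex.ofReal_zero, zero_mul, add_zero] at this
      exact this.mono_left nhdsWithin_le_nhds
    refine ⟨ht, ?_⟩
    filter_upwards [ht.eventually ((isOpen_Rect δ a b).mem_nhds hw), self_mem_nhdsWithin]
      with t ht1 ht2
    refine ⟨ht1, ?_⟩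
    simp [hwy, (Set.mem_Ioi.mp ht2).ne']
  have hnn : ∀ w ∈ Rect δ a b, 0 ≤ σ * (H w).re := by
    intro w hw
    by_cases hwy : w.im = y
    swap
    · exact (hoff w hw hwy).le
    have hcw : ContinuousAt (fun z => σ * (H z).re) w := by
      have := (hH.continuousOn).continuousAt ((isOpen_Rect δ a b).mem_nhds hw)
      exact continuousAt_const.mul (Complex.continuous_re.continuousAt.comp this)
    obtain ⟨ht, hev⟩ := happ w hw hwy
    exact ge_of_tendsto (hcw.tendsto.comp ht) (hev.mono fun t ht => (hoff _ ht.1 ht.2).le)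
  refine lt_of_le_of_ne (hnn z hz) fun h0 => ?_
  have hmax := Complex.eventually_eq_of_isLocalMax_norm
    (f := fun w => Complex.exp (-(σ * H w))) (c := z)
    (by
      filter_upwards [(isOpen_Rect δ a b).mem_nhds hz] with w hw
      exact ((hH.differentiableAt ((isOpen_Rect δ a b).mem_nhds hw)).const_mul _).neg.cexp)
    (by
      filter_upwards [hQn] with w hw
      simp only [Function.comp_apply, Complex.norm_exp, Complex.neg_re, Complex.re_ofReal_mul]
      rw [← h0]
      exact Real.exp_le_exp.mpr (by linarith [hnn w hw]))
  obtain ⟨ht, hev⟩ := happ z hz hzy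
  obtain ⟨t, ht1, ht2⟩ := ((ht.eventually hmax).and hev).exists
  have h3 := congrArg norm ht1
  simp only [Complex.norm_exp, Complex.neg_re, Complex.re_ofReal_mul] at h3
  rw [← h0] at h3
  have h4 := Real.exp_injective h3
  linarith [hoff _ ht2.1 ht2.2]

/-- Opposite signs force vanishing on the line. -/
lemma opp_sign (hay : a < y) {H : ℂ → ℂ}
    (hH : DifferentiableOn ℂ H (Rect δ a b)) {σ : ℝ}
    (h1 : ∀ z ∈ Rect δ a y, 0 < σ * (H z).re) (h2 : ∀ z ∈ Rect δ y b, 0 < -σ * (H z).re) :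
    ∀ z ∈ Rect δ a b, z.im = y → (H z).re = 0 := by
  intro z hz hzy
  have hQn : Rect δ a b ∈ 𝓝 z := (isOpen_Rect δ a b).mem_nhds hz
  have hcont : ContinuousAt (fun z => σ * (H z).re) z := by
    have := (hH.continuousOn).continuousAt hQn
    exact continuousAt_const.mul (Complex.continuous_re.continuousAt.comp this)
  have hc : Continuous (fun t : ℝ => z + t * I) := by fun_prop
  have ht0 := hc.tendsto 0
  simp only [Complex.ofReal_zero, zero_mul, add_zero] at ht0
  have hA : 0 ≤ σ * (H z).re := by
    have ht := ht0.mono_left (nhdsWithin_le_nhds (s := Iio 0))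
    refine ge_of_tendsto (hcont.tendsto.comp ht) ?_
    filter_upwards [ht.eventually hQn, self_mem_nhdsWithin] with t ht1 ht2
    have ht1' : z + t * I ∈ Rect δ a b := ht1
    have ht2' : t < 0 := ht2
    refine (h1 _ ⟨ht1'.1, ht1'.2.1, ?_⟩).le
    simp [hzy, ht2']
  have hB : σ * (H z).re ≤ 0 := by
    have ht := ht0.mono_left (nhdsWithin_le_nhds (s := Ioi 0))
    refine le_of_tendsto (hcont.tendsto.comp ht) ?_
    filter_upwards [ht.eventually hQn, self_mem_nhdsWithin] with t ht1 ht2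
    have ht1' : z + t * I ∈ Rect δ a b := ht1
    have ht2' : 0 < t := ht2
    have := h2 (z + t * I) ⟨ht1'.1, by simp [hzy, ht2'], ht1'.2.2⟩
    simp only [Function.comp_apply]
    linarith
  have h0 : σ * (H z).re = 0 := le_antisymm hB hA
  rcases mul_eq_zero.mp h0 with h | h
  · have hδ : 0 < δ := lt_of_le_of_lt (abs_nonneg _) hz.1
    have := h1 _ (midp_mem hδ hay)
    simp [h] at this
  · exact h

end

/-- Stereographic embedding of the Riemann sphere. -/
def emb : Option ℂ → ℂ × ℝ
  | Option.some z => (2 * z / ((1 + ‖z‖ ^ 2 : ℝ) : ℂ), 1 - 2 / (1 + ‖z‖ ^ 2))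
  | Option.none => (0, 1)

/-- Inversion on the Riemann sphere. -/
def sinv : Option ℂ → Option ℂ
  | Option.some z => if z = 0 then Option.none else Option.some z⁻¹
  | Option.none => Option.some 0

/-- The order three rotation `0 → 1 → ∞ → 0`. -/
def tau : Option ℂ → Option ℂ
  | Option.some z => if z = 1 then Option.none else Option.some (1 - z)⁻¹
  | Option.none => Option.some 0

lemma sinv_sinv (p : Option ℂ) : sinv (sinv p) = p := by
  cases p with
  | none => simp [sinv]
  | some z => by_cases h : z = 0 <;> simp [sinv, h]

lemma tau_tau_tau (p : Option ℂ) : tau (tau (tau p)) = p := by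
  cases p with
  | none => simp [tau]
  | some z =>
    by_cases h : z = 1
    · simp [tau, h]
    · have h1 : 1 - z ≠ 0 := sub_ne_zero.mpr (Ne.symm h)
      by_cases h0 : z = 0
      · simp [tau, h0]
      · have h2 : (1 - z)⁻¹ ≠ 1 := by
          intro hc
          rw [inv_eq_one] at hc
          exact h0 (by linear_combination -hc)
        have h3 : 1 - (1 - z)⁻¹ ≠ 0 := sub_ne_zero.mpr (Ne.symm h2)
        have h4 : (1 - (1 - z)⁻¹)⁻¹ ≠ 1 := by
          intro hc
          rw [inv_eq_one] at hc
          have : (1 - z)⁻¹ = 0 := by linear_combination -hc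
          exact h1 (inv_eq_zero.mp this)
        simp only [tau, h, h2, h4, if_false]
        congr 1
        have h5 : 1 - z - 1 ≠ 0 := by
          intro hc; exact h0 (by linear_combination -hc)
        have h6 : 1 - (1 - (1 - z)⁻¹)⁻¹ = z⁻¹ := by
          have : 1 - (1 - z)⁻¹ = -z / (1 - z) := by field_simp; ring
          rw [this, inv_div]
          field_simp
          ring
        rw [h6, inv_inv]

lemma sinv_tau_some (z : ℂ) : sinv (tau (Option.some z)) = Option.some (1 - z) := by
  by_cases h : z = 1
  · simp [tau, sinv, h]
  · have h1 : 1 - z ≠ 0 := sub_ne_zero.mpr (Ne.symm h)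
    simp [tau, sinv, h, h1]

lemma tau_eq_zero {p : Option ℂ} (h : tau p = Option.some 0) : p = Option.none := by
  rw [← tau_tau_tau p, h]; simp [tau]

lemma tau_eq_one {p : Option ℂ} (h : tau p = Option.some 1) : p = Option.some 0 := by
  rw [← tau_tau_tau p, h]; simp [tau]

lemma tau_eq_none {p : Option ℂ} (h : tau p = Option.none) : p = Option.some 1 := by
  rw [← tau_tau_tau p, h]; simp [tau]

/-- The unit sphere. -/
def Sph : Set (ℂ × ℝ) := {p | Complex.normSq p.1 + p.2 ^ 2 = 1}

lemma isCompact_Sph : IsCompact Sph := by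
  refine Metric.isCompact_of_isClosed_isBounded ?_ ?_
  · exact isClosed_eq (f := fun p : ℂ × ℝ => Complex.normSq p.1 + p.2 ^ 2)
      ((Complex.continuous_normSq.comp continuous_fst).add (by fun_prop)) continuous_const
  · refine (Metric.isBounded_closedBall (x := (0 : ℂ × ℝ)) (r := 1)).subset ?_
    intro p hp
    have hp' : Complex.normSq p.1 + p.2 ^ 2 = 1 := hp
    rw [mem_closedBall_zero_iff, Prod.norm_def, max_le_iff]
    have h1 : ‖p.1‖ ^ 2 ≤ 1 := by rw [Complex.sq_norm]; nlinarith
    have h2 : p.2 ^ 2 ≤ 1 := by nlinarith [Complex.normSq_nonneg p.1]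
    exact ⟨by nlinarith [norm_nonneg p.1], by rw [Real.norm_eq_abs]; exact abs_le_one_iff_mul_self_le_one.mpr (by nlinarith)⟩

lemma emb_mem (p : Option ℂ) : emb p ∈ Sph := by
  cases p with
  | none => simp [emb, Sph]
  | some z =>
    have h : (0 : ℝ) < 1 + ‖z‖ ^ 2 := by positivity
    have h2 : (1 + ‖z‖ ^ 2 : ℝ) ≠ 0 := h.ne'
    simp only [emb, Sph, Set.mem_ofPred_eq]
    rw [Complex.normSq_div, Complex.normSq_ofReal, Complex.normSq_mul, ← Complex.sq_norm z]
    have : Complex.normSq 2 = 4 := by norm_num [Complex.normSq_apply]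
    rw [this]
    field_simp
    ring

/-- Denominator of the rotation in sphere coordinates. -/
def tD (p : ℂ × ℝ) : ℝ := 1 + (1 - p.2) / 2 - p.1.re

/-- The rotation in sphere coordinates. -/
def tT (p : ℂ × ℝ) : ℂ × ℝ :=
  (((1 - p.2 : ℝ) - (starRingEnd ℂ) p.1) / (tD p : ℂ), (p.1.re - (1 + p.2) / 2) / tD p)

lemma tD_pos {p : ℂ × ℝ} (hp : p ∈ Sph) : 0 < tD p := by
  have hp' : p.1.re * p.1.re + p.1.im * p.1.im + p.2 ^ 2 = 1 := by
    have : Complex.normSq p.1 + p.2 ^ 2 = 1 := hp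
    rwa [Complex.normSq_apply] at this
  unfold tD
  by_contra h
  push Not at h
  nlinarith [sq_nonneg (p.1.re - 2 * p.2), sq_nonneg p.1.im, sq_nonneg (p.2 / 2 + p.1.re)]

lemma continuousOn_tT : ContinuousOn tT Sph := by
  have h1 : ContinuousOn tD Sph := by unfold tD; fun_prop
  refine ContinuousOn.prodMk ?_ ?_
  · refine ContinuousOn.div ?_ (Complex.continuous_ofReal.comp_continuousOn h1) ?_
    · have : Continuous (fun p : ℂ × ℝ => (((1 - p.2 : ℝ) : ℂ) - (starRingEnd ℂ) p.1)) := by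
        fun_prop
      exact this.continuousOn
    · intro p hp; exact_mod_cast (tD_pos hp).ne'
  · refine ContinuousOn.div (by fun_prop) h1 (fun p hp => (tD_pos hp).ne')

lemma emb_tau (p : Option ℂ) : emb (tau p) = tT (emb p) := by
  cases p with
  | none => norm_num [tau, emb, tT, tD]
  | some z =>
    have hn : ‖z‖ ^ 2 = z.re * z.re + z.im * z.im := by
      rw [Complex.sq_norm, Complex.normSq_apply]
    by_cases h : z = 1
    · subst h
      norm_num [tau, emb, tT, tD]
    · have h1 : 1 - z ≠ 0 := sub_ne_zero.mpr (Ne.symm h)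
      have hq : (0 : ℝ) < 1 + ‖z‖ ^ 2 := by positivity
      have hq2 : (1 + ‖z‖ ^ 2 : ℝ) ≠ 0 := hq.ne'
      have hs : 0 < ‖1 - z‖ ^ 2 := by positivity
      have hss : ‖1 - z‖ ^ 2 = 1 - 2 * z.re + ‖z‖ ^ 2 := by
        rw [hn, Complex.sq_norm, Complex.normSq_apply]; simp; ring
      have hre : (2 * z / ((1 + ‖z‖ ^ 2 : ℝ) : ℂ)).re = 2 * z.re / (1 + ‖z‖ ^ 2) := by
        rw [Complex.div_ofReal_re]; simp
      have hD : tD (emb (Option.some z)) = (1 + ‖1 - z‖ ^ 2) / (1 + ‖z‖ ^ 2) := by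
        simp only [tD, emb]
        rw [hre, hss]; field_simp; ring
      have hw : ‖(1 - z)⁻¹‖ ^ 2 = (‖1 - z‖ ^ 2)⁻¹ := by rw [norm_inv, inv_pow]
      have hden : (1 + ‖(1 - z)⁻¹‖ ^ 2 : ℝ) = (1 + ‖1 - z‖ ^ 2) / ‖1 - z‖ ^ 2 := by
        rw [hw]; field_simp; ring
      have hinv : (1 - z)⁻¹ = (starRingEnd ℂ) (1 - z) / ((‖1 - z‖ ^ 2 : ℝ) : ℂ) := by
        rw [Complex.inv_def, Complex.sq_norm, div_eq_mul_inv, Complex.ofReal_inv]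
      have hs' : ((‖1 - z‖ ^ 2 : ℝ) : ℂ) ≠ 0 := by exact_mod_cast hs.ne'
      have hs1 : ((1 + ‖1 - z‖ ^ 2 : ℝ) : ℂ) ≠ 0 := by
        exact_mod_cast (by positivity : (0 : ℝ) < 1 + ‖1 - z‖ ^ 2).ne'
      have hq' : ((1 + ‖z‖ ^ 2 : ℝ) : ℂ) ≠ 0 := by exact_mod_cast hq2
      have he : emb (tau (Option.some z)) =
          (2 * (1 - z)⁻¹ / ((1 + ‖(1 - z)⁻¹‖ ^ 2 : ℝ) : ℂ), 1 - 2 / (1 + ‖(1 - z)⁻¹‖ ^ 2)) := by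
        simp only [tau, h, if_false, emb]
      rw [he]
      apply Prod.ext
      · simp only [tT, hD]
        rw [hden, hinv]
        simp only [emb, map_sub, map_one, map_div₀, map_mul, Complex.conj_ofReal]
        rw [Complex.ofReal_div, Complex.ofReal_div]
        have h2 : (starRingEnd ℂ) 2 = 2 := by
          simpa using Complex.conj_ofReal 2
        rw [h2, Complex.ofReal_sub, Complex.ofReal_sub, Complex.ofReal_div]
        generalize ((1 + ‖z‖ ^ 2 : ℝ) : ℂ) = q at *
        generalize ((1 + ‖1 - z‖ ^ 2 : ℝ) : ℂ) = s1 at *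
        generalize ((‖1 - z‖ ^ 2 : ℝ) : ℂ) = s at *
        simp only [Complex.ofReal_one, Complex.ofReal_ofNat]
        field_simp
        ring
      · simp only [tT, hD]
        rw [hden]
        simp only [emb]
        rw [hre]
        have : (1 + ‖1 - z‖ ^ 2 : ℝ) ≠ 0 := by positivity
        field_simp
        rw [hss]; ring

lemma emb_sinv (p : Option ℂ) : emb (sinv p) = ((starRingEnd ℂ) (emb p).1, -(emb p).2) := by
  cases p with
  | none => norm_num [sinv, emb]
  | some z =>
    by_cases h : z = 0
    · norm_num [sinv, emb, h]
    · have hs : 0 < ‖z‖ ^ 2 := by positivity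
      have hq : (0 : ℝ) < 1 + ‖z‖ ^ 2 := by positivity
      have hw : ‖z⁻¹‖ ^ 2 = (‖z‖ ^ 2)⁻¹ := by rw [norm_inv, inv_pow]
      have hden : (1 + ‖z⁻¹‖ ^ 2 : ℝ) = (1 + ‖z‖ ^ 2) / ‖z‖ ^ 2 := by
        rw [hw]; field_simp; ring
      have hinv : z⁻¹ = (starRingEnd ℂ) z / ((‖z‖ ^ 2 : ℝ) : ℂ) := by
        rw [Complex.inv_def, Complex.sq_norm, div_eq_mul_inv, Complex.ofReal_inv]
      have hs' : ((‖z‖ ^ 2 : ℝ) : ℂ) ≠ 0 := by exact_mod_cast hs.ne'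
      have hq' : ((1 + ‖z‖ ^ 2 : ℝ) : ℂ) ≠ 0 := by exact_mod_cast hq.ne'
      have he : emb (sinv (Option.some z)) =
          (2 * z⁻¹ / ((1 + ‖z⁻¹‖ ^ 2 : ℝ) : ℂ), 1 - 2 / (1 + ‖z⁻¹‖ ^ 2)) := by
        simp only [sinv, h, if_false, emb]
      rw [he]
      apply Prod.ext
      · rw [hden, hinv]
        simp only [emb, map_div₀, map_mul, Complex.conj_ofReal]
        have h2 : (starRingEnd ℂ) 2 = 2 := by
          simpa using Complex.conj_ofReal 2
        rw [h2, Complex.ofReal_div]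
        generalize ((1 + ‖z‖ ^ 2 : ℝ) : ℂ) = q at *
        generalize ((‖z‖ ^ 2 : ℝ) : ℂ) = s at *
        field_simp
      · rw [hden]
        simp only [emb]
        field_simp
        ring

/-- Convergence on the sphere. -/
def STo (x : ℕ → Option ℂ) (p : Option ℂ) : Prop :=
  Tendsto (fun k => emb (x k)) atTop (𝓝 (emb p))

lemma STo.comp {x : ℕ → Option ℂ} {p : Option ℂ} (h : STo x p) {φ : ℕ → ℕ} (hφ : StrictMono φ) :
    STo (fun k => x (φ k)) p := Tendsto.comp h hφ.tendsto_atTop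

lemma STo.tau {x : ℕ → Option ℂ} {p : Option ℂ} (h : STo x p) :
    STo (fun k => tau (x k)) (tau p) := by
  unfold STo at *
  simp only [emb_tau]
  exact (continuousOn_tT (emb p) (emb_mem p)).tendsto.comp
    (tendsto_nhdsWithin_iff.mpr ⟨h, Eventually.of_forall fun k => emb_mem _⟩)

lemma STo.untau {x : ℕ → Option ℂ} {p : Option ℂ} (h : STo (fun k => _root_.tau (x k)) p) :
    STo x (_root_.tau (_root_.tau p)) := by
  have := h.tau.tau
  simpa only [tau_tau_tau] using this

lemma STo.sinv {x : ℕ → Option ℂ} {p : Option ℂ} (h : STo x p) :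
    STo (fun k => sinv (x k)) (sinv p) := by
  unfold STo at *
  simp only [emb_sinv]
  have hc : Continuous (fun q : ℂ × ℝ => ((starRingEnd ℂ) q.1, -q.2)) := by fun_prop
  exact (hc.tendsto (emb p)).comp h

lemma continuous_emb_some : Continuous (fun z : ℂ => emb (Option.some z)) := by
  unfold emb
  refine Continuous.prodMk ?_ ?_
  · refine Continuous.div (by fun_prop) (by fun_prop) (fun z => ?_)
    exact_mod_cast (by positivity : (0 : ℝ) < 1 + ‖z‖ ^ 2).ne'
  · refine continuous_const.sub (Continuous.div (by fun_prop) (by fun_prop) (fun z => ?_))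
    exact (by positivity : (0 : ℝ) < 1 + ‖z‖ ^ 2).ne'

lemma STo_some_iff {x : ℕ → ℂ} {c : ℂ} :
    STo (fun k => Option.some (x k)) (Option.some c) ↔ Tendsto x atTop (𝓝 c) := by
  constructor
  · intro h
    have hkey : ∀ z : ℂ, (emb (Option.some z)).1 / ((1 - (emb (Option.some z)).2 : ℝ) : ℂ) = z := by
      intro z
      simp only [emb]
      have : ((1 + ‖z‖ ^ 2 : ℝ) : ℂ) ≠ 0 := by
        exact_mod_cast (by positivity : (0 : ℝ) < 1 + ‖z‖ ^ 2).ne'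
      rw [sub_sub_cancel, Complex.ofReal_div]
      simp only [Complex.ofReal_ofNat]
      field_simp
    have h1 := (continuous_fst.tendsto _).comp h
    have h2 := (continuous_snd.tendsto _).comp h
    have h3 := h1.div (((Complex.continuous_ofReal).tendsto _).comp (h2.const_sub 1)) (by
      simp only [emb]
      rw [sub_sub_cancel]
      exact_mod_cast (by positivity : (0 : ℝ) < 2 / (1 + ‖c‖ ^ 2)).ne')
    rw [hkey c] at h3
    exact h3.congr fun k => hkey (x k)
  · intro h
    exact (continuous_emb_some.tendsto c).comp h

lemma STo_none_iff {x : ℕ → ℂ} :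
    STo (fun k => Option.some (x k)) Option.none ↔ Tendsto (fun k => ‖x k‖) atTop atTop := by
  constructor
  · intro h
    have h2 := (continuous_snd.tendsto _).comp h
    simp only [emb] at h2
    have h3 : Tendsto (fun k => (1 + ‖x k‖ ^ 2)⁻¹) atTop (𝓝 0) := by
      have := (h2.const_sub 1).mul_const 2⁻¹
      simp only [sub_self, zero_mul] at this
      refine this.congr fun k => ?_
      simp only [Function.comp_apply, sub_sub_cancel]
      ring
    have h4 : Tendsto (fun k => (1 + ‖x k‖ ^ 2)) atTop atTop := by
      have h5 : Tendsto (fun k => (1 + ‖x k‖ ^ 2)⁻¹) atTop (𝓝[>] 0) :=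
        tendsto_nhdsWithin_iff.mpr ⟨h3, Eventually.of_forall fun k => by
          show (0 : ℝ) < _; positivity⟩
      exact h5.inv_tendsto_nhdsGT_zero.congr (fun k => by simp)
    rw [tendsto_atTop] at h4 ⊢
    intro B
    filter_upwards [h4 (1 + |B| ^ 2)] with k hk
    have : |B| ≤ ‖x k‖ := by
      have := abs_nonneg B
      exact (pow_le_pow_iff_left₀ this (norm_nonneg _) two_ne_zero).mp (by linarith)
    exact (le_abs_self B).trans this
  · intro h
    have h4 : Tendsto (fun k => (1 + ‖x k‖ ^ 2)) atTop atTop :=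
      tendsto_atTop_add_const_left _ _ ((tendsto_pow_atTop two_ne_zero).comp h)
    have h3 : Tendsto (fun k => (1 + ‖x k‖ ^ 2)⁻¹) atTop (𝓝 0) := tendsto_inv_atTop_zero.comp h4
    have h2 : Tendsto (fun k => 1 - 2 / (1 + ‖x k‖ ^ 2)) atTop (𝓝 1) := by
      have := (h3.const_mul 2).const_sub 1
      simpa [div_eq_mul_inv] using this
    have h1 : Tendsto (fun k => 2 * x k / ((1 + ‖x k‖ ^ 2 : ℝ) : ℂ)) atTop (𝓝 0) := by
      rw [tendsto_zero_iff_norm_tendsto_zero]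
      have hinv : Tendsto (fun k => 2 * ‖x k‖⁻¹) atTop (𝓝 0) := by
        have := (tendsto_inv_atTop_zero.comp h).const_mul 2
        simpa using this
      refine tendsto_of_tendsto_of_tendsto_of_le_of_le' tendsto_const_nhds hinv
        (Eventually.of_forall fun k => norm_nonneg _) ?_
      filter_upwards [h.eventually_gt_atTop 0] with k hk
      rw [norm_div, norm_mul, Complex.norm_real, Real.norm_of_nonneg (by positivity),
        div_le_iff₀ (by positivity)]
      simp only [Complex.norm_ofNat]
      have : 2 * ‖x k‖⁻¹ * (1 + ‖x k‖ ^ 2) = 2 * ‖x k‖⁻¹ + 2 * ‖x k‖ := by field_simp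
      rw [this]
      have : 0 < ‖x k‖⁻¹ := by positivity
      linarith
    unfold STo
    simp only [emb]
    exact h1.prodMk_nhds h2

lemma STo_exp_none {h : ℕ → ℂ} : STo (fun k => Option.some (Complex.exp (h k))) Option.none ↔
    Tendsto (fun k => (h k).re) atTop atTop := by
  rw [STo_none_iff]
  simp only [Complex.norm_exp]
  exact Real.tendsto_exp_comp_atTop

lemma STo_exp_zero {h : ℕ → ℂ} : STo (fun k => Option.some (Complex.exp (h k)))
    (Option.some 0) ↔ Tendsto (fun k => (h k).re) atTop atBot := by
  have h1 : STo (fun k => Option.some (Complex.exp (h k))) (Option.some 0) ↔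
      STo (fun k => Option.some (Complex.exp (-h k))) Option.none := by
    constructor
    · intro hh; simpa [sinv, Complex.exp_ne_zero, Complex.exp_neg] using hh.sinv
    · intro hh; simpa [sinv, Complex.exp_ne_zero, Complex.exp_neg] using hh.sinv
  rw [h1, STo_exp_none]
  simp only [Complex.neg_re]
  exact tendsto_neg_atTop_iff

lemma emb_injective : Function.Injective emb := by
  intro p q hpq
  have hk : ∀ z : ℂ, (emb (Option.some z)).2 ≠ 1 := by
    intro z hz
    simp only [emb] at hz
    have : 0 < 2 / (1 + ‖z‖ ^ 2) := by positivity
    linarith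
  cases p with
  | none =>
    cases q with
    | none => rfl
    | some w => exact absurd (congrArg Prod.snd hpq).symm (by simpa [emb] using hk w)
  | some z =>
    cases q with
    | none => exact absurd (congrArg Prod.snd hpq) (by simpa [emb] using hk z)
    | some w =>
      have : STo (fun _ => Option.some z) (Option.some w) := by
        show Tendsto (fun _ => emb (Option.some z)) atTop (𝓝 (emb (Option.some w)))
        rw [hpq]; exact tendsto_const_nhds
      rw [STo_some_iff] at this
      rw [tendsto_nhds_unique tendsto_const_nhds this]

lemma STo.unique {x : ℕ → Option ℂ} {p q : Option ℂ} (h : STo x p) (h' : STo x q) : p = q :=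
  emb_injective (tendsto_nhds_unique h h')

/-- Local meromorphy of a sphere valued map. -/
def Chart (Φ : ℂ → Option ℂ) (z : ℂ) : Prop :=
  (∃ g : ℂ → ℂ, AnalyticAt ℂ g z ∧ ∀ᶠ w in 𝓝 z, Φ w = Option.some (g w)) ∨
  (∃ g : ℂ → ℂ, AnalyticAt ℂ g z ∧ ∀ᶠ w in 𝓝 z, sinv (Φ w) = Option.some (g w))

/-- The class of periodic functions in logarithmic coordinates. -/
structure Cls (δ y0 y1 y2 : ℝ) (Φ : ℂ → Option ℂ) : Prop where
  chart : ∀ z : ℂ, |z.re| < δ → Chart Φ z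
  per : ∀ z : ℂ, Φ (z + 2 * Real.pi * I) = Φ z
  zero : ∀ z : ℂ, |z.re| < δ → Φ z = Option.some 0 → ∃ n : ℤ, z.im = y0 + n * (2 * Real.pi)
  one : ∀ z : ℂ, |z.re| < δ → Φ z = Option.some 1 → ∃ n : ℤ, z.im = y1 + n * (2 * Real.pi)
  pole : ∀ z : ℂ, |z.re| < δ → Φ z = Option.none → ∃ n : ℤ, z.im = y2 + n * (2 * Real.pi)

lemma Chart.sinv {Φ : ℂ → Option ℂ} {z : ℂ} (h : Chart Φ z) :
    Chart (fun w => _root_.sinv (Φ w)) z := by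
  rcases h with h | h
  · right
    simpa only [sinv_sinv] using h
  · left; exact h

lemma Chart.tau {Φ : ℂ → Option ℂ} {z : ℂ} (h : Chart Φ z) :
    Chart (fun w => _root_.tau (Φ w)) z := by
  rcases h with ⟨g, hg, h⟩ | ⟨g, hg, h⟩
  · right
    refine ⟨fun w => 1 - g w, analyticAt_const.sub hg, ?_⟩
    filter_upwards [h] with w hw
    rw [hw, sinv_tau_some]
  · have h' : ∀ᶠ w in 𝓝 z, Φ w = _root_.sinv (Option.some (g w)) := by
      filter_upwards [h] with w hw
      rw [← hw, sinv_sinv]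
    by_cases h1 : g z = 1
    · right
      have h0 : g z ≠ 0 := by rw [h1]; exact one_ne_zero
      refine ⟨fun w => 1 - (g w)⁻¹, analyticAt_const.sub (hg.inv h0), ?_⟩
      filter_upwards [h', hg.continuousAt.eventually_ne h0] with w hw hw0
      rw [hw]
      have : _root_.sinv (Option.some (g w)) = Option.some (g w)⁻¹ := by simp [_root_.sinv, hw0]
      rw [this, sinv_tau_some]
    · left
      refine ⟨fun w => g w / (g w - 1), hg.div (hg.sub analyticAt_const) (sub_ne_zero.mpr h1), ?_⟩
      filter_upwards [h', hg.continuousAt.eventually_ne h1] with w hw hw1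
      rw [hw]
      by_cases hw0 : g w = 0
      · simp [_root_.sinv, hw0, _root_.tau]
      · have h2 : (g w)⁻¹ ≠ 1 := by rwa [Ne, inv_eq_one]
        simp only [_root_.sinv, hw0, if_false, _root_.tau, h2]
        congr 1
        have : g w - 1 ≠ 0 := sub_ne_zero.mpr hw1
        have h3 : 1 - (g w)⁻¹ = (g w - 1) / g w := by field_simp
        rw [h3, inv_div]

lemma Cls.tau {δ y0 y1 y2 : ℝ} {Φ : ℂ → Option ℂ} (h : Cls δ y0 y1 y2 Φ) :
    Cls δ y2 y0 y1 (fun z => _root_.tau (Φ z)) where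
  chart z hz := (h.chart z hz).tau
  per z := by simp only [h.per]
  zero z hz hw := h.pole z hz (tau_eq_zero hw)
  one z hz hw := h.zero z hz (tau_eq_one hw)
  pole z hz hw := h.one z hz (tau_eq_none hw)

lemma Cls.sinv {δ y0 y1 y2 : ℝ} {Φ : ℂ → Option ℂ} (h : Cls δ y0 y1 y2 Φ) :
    Cls δ y2 y1 y0 (fun z => _root_.sinv (Φ z)) where
  chart z hz := (h.chart z hz).sinv
  per z := by simp only [h.per]
  zero z hz hw := h.pole z hz (by rw [← sinv_sinv (Φ z), hw]; simp [_root_.sinv])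
  one z hz hw := h.one z hz (by rw [← sinv_sinv (Φ z), hw]; simp [_root_.sinv])
  pole z hz hw := h.zero z hz (by rw [← sinv_sinv (Φ z), hw]; simp [_root_.sinv])

lemma Cls.shift {δ y0 y1 y2 : ℝ} {Φ : ℂ → Option ℂ} (h : Cls δ y0 y1 y2 Φ) (a b c : ℤ) :
    Cls δ (y0 + a * (2 * Real.pi)) (y1 + b * (2 * Real.pi)) (y2 + c * (2 * Real.pi)) Φ where
  chart := h.chart
  per := h.per
  zero z hz hw := by
    obtain ⟨n, hn⟩ := h.zero z hz hw
    exact ⟨n - a, by rw [hn]; push_cast; ring⟩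
  one z hz hw := by
    obtain ⟨n, hn⟩ := h.one z hz hw
    exact ⟨n - b, by rw [hn]; push_cast; ring⟩
  pole z hz hw := by
    obtain ⟨n, hn⟩ := h.pole z hz hw
    exact ⟨n - c, by rw [hn]; push_cast; ring⟩

/-- First rotation with shifted angles. -/
lemma Cls.rot1 {δ y0 y1 y2 : ℝ} {Φ : ℂ → Option ℂ} (h : Cls δ y0 y1 y2 Φ) :
    Cls δ y2 (y0 + 2 * Real.pi) (y1 + 2 * Real.pi) (fun z => _root_.tau (Φ z)) := by
  have := h.tau.shift 0 1 1
  simpa using this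

/-- Second rotation with shifted angles. -/
lemma Cls.rot2 {δ y0 y1 y2 : ℝ} {Φ : ℂ → Option ℂ} (h : Cls δ y0 y1 y2 Φ) :
    Cls δ y1 y2 (y0 + 2 * Real.pi) (fun z => _root_.tau (_root_.tau (Φ z))) := by
  have := h.tau.tau.shift 0 0 1
  simpa using this

lemma int_gap {y a b : ℝ} {n : ℤ} (hb : b ≤ a + 2 * Real.pi) (h1 : a < y + n * (2 * Real.pi))
    (h2 : y + n * (2 * Real.pi) < b) (h3 : y = a ∨ y = b) : False := by
  have hp := Real.pi_pos
  rcases h3 with rfl | rfl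
  · have h4 : (0 : ℝ) < n := by
      by_contra hc; push Not at hc; nlinarith
    have h5 : (1 : ℝ) ≤ n := by exact_mod_cast (by exact_mod_cast h4 : (0 : ℤ) < n)
    nlinarith
  · have h4 : (n : ℝ) < 0 := by
      by_contra hc; push Not at hc; nlinarith
    have h5 : (n : ℝ) ≤ -1 := by
      have : n < 0 := by exact_mod_cast h4
      exact_mod_cast (by omega : n ≤ -1)
    nlinarith

lemma cls_log {δ y0 y1 y2 : ℝ} (h01 : y0 < y1) (h12 : y1 < y2)
    (h20 : y2 < y0 + 2 * Real.pi) {Φ : ℂ → Option ℂ} (h : Cls δ y0 y1 y2 Φ) :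
    ∃ l : ℂ → ℂ, LogF δ y0 y1 y2 l ∧ ∀ z ∈ Rect δ y0 y2, Φ z = Option.some (Complex.exp (l z)) := by
  have hpole : ∀ z ∈ Rect δ y0 y2, Φ z ≠ Option.none := by
    intro z hz hc
    obtain ⟨n, hn⟩ := h.pole z hz.1 hc
    exact int_gap h20.le (hn ▸ hz.2.1) (hn ▸ hz.2.2) (Or.inr rfl)
  have hzero : ∀ z ∈ Rect δ y0 y2, Φ z ≠ Option.some 0 := by
    intro z hz hc
    obtain ⟨n, hn⟩ := h.zero z hz.1 hc
    exact int_gap h20.le (hn ▸ hz.2.1) (hn ▸ hz.2.2) (Or.inl rfl)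
  have hsome : ∀ z ∈ Rect δ y0 y2, Φ z = Option.some ((Φ z).getD 0) := by
    intro z hz
    cases hq : Φ z with
    | none => exact absurd hq (hpole z hz)
    | some w => rfl
  have hdiff : DifferentiableOn ℂ (fun z => (Φ z).getD 0) (Rect δ y0 y2) := by
    intro z hz
    apply DifferentiableAt.differentiableWithinAt
    rcases h.chart z hz.1 with ⟨g, hg, hw⟩ | ⟨g, hg, hw⟩
    · refine hg.differentiableAt.congr_of_eventuallyEq ?_
      filter_upwards [hw] with w hw
      rw [hw]; rfl
    · have h0 : g z ≠ 0 := by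
        intro hc
        have h1 := hw.self_of_nhds
        rw [hc] at h1
        exact hpole z hz (by rw [← sinv_sinv (Φ z), h1]; simp [_root_.sinv])
      refine (hg.inv h0).differentiableAt.congr_of_eventuallyEq ?_
      filter_upwards [hw, hg.continuousAt.eventually_ne h0] with w hw hw0
      rw [← sinv_sinv (Φ w), hw]; simp [_root_.sinv, hw0]
  obtain ⟨l, hl, hexp⟩ := exists_log_of_convex (convex_Rect δ y0 y2) (isOpen_Rect δ y0 y2) hdiff
    (fun z hz hc => hzero z hz (by rw [hsome z hz, hc]))
  have hP : ∀ z ∈ Rect δ y0 y2, Φ z = Option.some (Complex.exp (l z)) := fun z hz => by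
    rw [hexp z hz]; exact hsome z hz
  refine ⟨l, ⟨hl, ?_⟩, hP⟩
  intro z hz hy hc
  obtain ⟨n, hn⟩ := h.one z hz.1 (by rw [hP z hz, hc])
  rcases lt_or_gt_of_ne hy with hlt | hgt
  · exact int_gap (a := y0) (b := y1) (by linarith) (hn ▸ hz.2.1) (hn ▸ hlt) (Or.inr rfl)
  · exact int_gap (a := y1) (b := y2) (by linarith) (hn ▸ hgt) (hn ▸ hz.2.2) (Or.inl rfl)

/-- Infinity for positive sign and zero for negative sign. -/
def pt (σ : ℝ) : Option ℂ := if σ = 1 then Option.none else Option.some 0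

lemma pt_one : pt 1 = Option.none := by simp [pt]
lemma pt_neg : pt (-1) = Option.some 0 := by norm_num [pt]

lemma re_lim {h : ℕ → ℂ} {M : ℕ → ℝ} {σ c : ℝ} (hM : Tendsto M atTop atTop)
    (hc : Tendsto (fun k => (h k).re / M k) atTop (𝓝 c)) (hσ : σ = 1 ∨ σ = -1)
    (hpos : 0 < σ * c) : STo (fun k => Option.some (Complex.exp (h k))) (pt σ) := by
  have heq : ∀ᶠ k in atTop, (h k).re / M k * M k = (h k).re := by
    filter_upwards [hM.eventually_gt_atTop 0] with k hk
    exact div_mul_cancel₀ _ hk.ne'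
  rcases hσ with rfl | rfl
  · rw [pt_one, STo_exp_none]
    exact (hc.pos_mul_atTop (by linarith) hM).congr' heq
  · rw [pt_neg, STo_exp_zero]
    exact (hc.neg_mul_atTop (by linarith) hM).congr' heq

lemma abs_re_lim {h : ℕ → ℂ} {p : Option ℂ} (hp : p = Option.none ∨ p = Option.some 0)
    (hS : STo (fun k => Option.some (Complex.exp (h k))) p) :
    Tendsto (fun k => |(h k).re|) atTop atTop := by
  rcases hp with rfl | rfl
  · exact tendsto_abs_atTop_atTop.comp (STo_exp_none.mp hS)
  · exact tendsto_abs_atBot_atTop.comp (STo_exp_zero.mp hS)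

lemma mag_lower {y0 y1 y2 : ℝ} {l : ℕ → ℂ → ℂ} {p : Option ℂ}
    (hp : p = Option.none ∨ p = Option.some 0)
    (hS : STo (fun k => Option.some (Complex.exp (l k (midp y0 y1)))) p) :
    Tendsto (fun k => Mag y0 y1 y2 (l k)) atTop atTop := by
  refine tendsto_atTop_mono (fun k => ?_) (abs_re_lim hp hS)
  unfold Mag
  linarith [abs_nonneg (l k (midp y1 y2)).re]

lemma mag_upper {y0 y1 y2 : ℝ} {l : ℕ → ℂ → ℂ} {p : Option ℂ}
    (hp : p = Option.none ∨ p = Option.some 0)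
    (hS : STo (fun k => Option.some (Complex.exp (l k (midp y1 y2)))) p) :
    Tendsto (fun k => Mag y0 y1 y2 (l k)) atTop atTop := by
  refine tendsto_atTop_mono (fun k => ?_) (abs_re_lim hp hS)
  unfold Mag
  linarith [abs_nonneg (l k (midp y0 y1)).re]

lemma cls_big {δ y0 y1 y2 : ℝ} (hδ : 0 < δ) (h01 : y0 < y1) (h12 : y1 < y2)
    {Φ : ℕ → ℂ → Option ℂ} {l : ℕ → ℂ → ℂ} (hl : ∀ k, LogF δ y0 y1 y2 (l k))
    (hP : ∀ k, ∀ z ∈ Rect δ y0 y2, Φ k z = Option.some (Complex.exp (l k z)))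
    (hM : Tendsto (fun k => Mag y0 y1 y2 (l k)) atTop atTop) :
    ∃ φ : ℕ → ℕ, StrictMono φ ∧ ∃ H : ℂ → ℂ, DifferentiableOn ℂ H (Rect δ y0 y2) ∧
      (∀ z ∈ Rect δ y0 y2, ∀ w : ℕ → ℂ, Tendsto w atTop (𝓝 z) →
        Tendsto (fun k => (l (φ k) (w k)).re / Mag y0 y1 y2 (l (φ k))) atTop (𝓝 (H z).re)) ∧
      ∃ σ₁ σ₂ : ℝ, (σ₁ = 1 ∨ σ₁ = -1) ∧ (σ₂ = 1 ∨ σ₂ = -1) ∧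
        (∀ z ∈ Rect δ y0 y1, 0 < σ₁ * (H z).re) ∧ (∀ z ∈ Rect δ y1 y2, 0 < σ₂ * (H z).re) ∧
        (∀ z ∈ Rect δ y0 y1, STo (fun k => Φ (φ k) z) (pt σ₁)) ∧
        (∀ z ∈ Rect δ y1 y2, STo (fun k => Φ (φ k) z) (pt σ₂)) := by
  obtain ⟨φ, hφ, H, hH, hconv, σ₁, σ₂, hs1, hs2, hp1, hp2⟩ := rect_big hδ h01 h12 l hl hM
  have hM' := hM.comp hφ.tendsto_atTop
  refine ⟨φ, hφ, H, hH, hconv, σ₁, σ₂, hs1, hs2, hp1, hp2, ?_, ?_⟩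
  · intro z hz
    have hz' := Rect_mono le_rfl h12.le hz
    have := re_lim hM' (hconv z hz' (fun _ => z) tendsto_const_nhds) hs1 (hp1 z hz)
    simpa only [hP _ z hz'] using this
  · intro z hz
    have hz' := Rect_mono h01.le le_rfl hz
    have := re_lim hM' (hconv z hz' (fun _ => z) tendsto_const_nhds) hs2 (hp2 z hz)
    simpa only [hP _ z hz'] using this

/-- The canonical limit configuration. -/
def Canon (y0 y1 y2 : ℝ) (Φ : ℕ → ℂ → Option ℂ) : Prop :=
  STo (fun k => Φ k (midp y0 y1)) Option.none ∧ STo (fun k => Φ k (midp y1 y2)) (Option.some 0) ∧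
    STo (fun k => Φ k (midp y2 (y0 + 2 * Real.pi))) (Option.some 1)

lemma midp_shift (a b : ℝ) :
    midp (a + 2 * Real.pi) (b + 2 * Real.pi) = midp a b + 2 * Real.pi * I := by
  apply Complex.ext <;> simp [midp]; ring

lemma Cls.sub {δ y0 y1 y2 : ℝ} {Φ : ℂ → Option ℂ} (h : Cls δ y0 y1 y2 Φ) (z : ℂ) :
    Φ (z - 2 * Real.pi * I) = Φ z := by
  rw [← h.per (z - 2 * Real.pi * I), sub_add_cancel]

lemma tau_some_zero : tau (Option.some 0) = Option.some 1 := by simp [tau]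
lemma tau_some_one : tau (Option.some 1) = Option.none := by simp [tau]
lemma tau_none : tau Option.none = Option.some 0 := by simp [tau]

lemma rect_sub {δ a b : ℝ} {z : ℂ} (hz : z ∈ Rect δ (a + 2 * Real.pi) (b + 2 * Real.pi)) :
    z - 2 * Real.pi * I ∈ Rect δ a b := by
  obtain ⟨h1, h2, h3⟩ := hz
  refine ⟨by simpa using h1, ?_, ?_⟩ <;> simp <;> linarith

/-- Orientation one yields the canonical configuration. -/
lemma orient_pos {δ y0 y1 y2 : ℝ} (hδ : 0 < δ) (h01 : y0 < y1) (h12 : y1 < y2)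
    (h20 : y2 < y0 + 2 * Real.pi) {Φ : ℕ → ℂ → Option ℂ} (hΦ : ∀ k, Cls δ y0 y1 y2 (Φ k))
    (ha : STo (fun k => Φ k (midp y0 y1)) Option.none)
    (hb : STo (fun k => Φ k (midp y1 y2)) (Option.some 0)) :
    ∃ φ : ℕ → ℕ, StrictMono φ ∧ Canon y0 y1 y2 (fun k => Φ (φ k)) := by
  choose l hl hP using fun k => cls_log h20 (by linarith) (by linarith) (hΦ k).rot1
  have e1 : midp (y0 + 2 * Real.pi) (y1 + 2 * Real.pi) ∈ Rect δ y2 (y1 + 2 * Real.pi) :=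
    Rect_mono h20.le le_rfl (midp_mem hδ (by linarith))
  have hM : Tendsto (fun k => Mag y2 (y0 + 2 * Real.pi) (y1 + 2 * Real.pi) (l k)) atTop atTop := by
    refine mag_upper (p := Option.some 0) (Or.inr rfl) ?_
    have := ha.tau
    rw [tau_none] at this
    simp only [← hP _ _ e1]
    simpa only [midp_shift, (hΦ _).per] using this
  obtain ⟨φ, hφ, H, -, -, σ, σ', hσ, -, -, -, hS, -⟩ :=
    cls_big hδ h20 (by linarith) (Φ := fun k z => tau (Φ k z)) hl hP hM
  have hSm := (hS _ (midp_mem hδ h20)).tau.tau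
  simp only [tau_tau_tau] at hSm
  choose l' hl' hP' using fun k => cls_log h12 h20 (by linarith) (hΦ (φ k)).rot2
  have e2 : midp y1 y2 ∈ Rect δ y1 (y0 + 2 * Real.pi) :=
    Rect_mono le_rfl h20.le (midp_mem hδ h12)
  have hM' : Tendsto (fun k => Mag y1 y2 (y0 + 2 * Real.pi) (l' k)) atTop atTop := by
    refine mag_lower (p := Option.none) (Or.inl rfl) ?_
    have := (hb.comp hφ).tau.tau
    rw [tau_some_zero, tau_some_one] at this
    simpa only [← hP' _ _ e2] using this
  obtain ⟨ψ, hψ, H', -, -, σ₁, σ₂, -, hσ₂, -, -, -, hS'⟩ :=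
    cls_big hδ h12 h20 (Φ := fun k z => tau (tau (Φ (φ k) z))) hl' hP' hM'
  have hSm' := (hS' _ (midp_mem hδ h20)).tau
  simp only [tau_tau_tau] at hSm'
  have huniq := (hSm.comp hψ).unique hSm'
  refine ⟨fun k => φ (ψ k), hφ.comp hψ, (ha.comp hφ).comp hψ, (hb.comp hφ).comp hψ, ?_⟩
  have : tau (pt σ₂) = Option.some 1 := by
    rcases hσ with rfl | rfl <;> rcases hσ₂ with rfl | rfl <;>
      simp [pt_one, pt_neg, tau_none, tau_some_zero, tau_some_one] at huniq ⊢
  rw [this] at hSm'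
  exact hSm'

lemma STo_exp_one {h : ℕ → ℂ} (hS : STo (fun k => Option.some (Complex.exp (h k)))
    (Option.some 1)) : Tendsto (fun k => Complex.exp (h k)) atTop (𝓝 1) := STo_some_iff.mp hS

/-- The other orientation is impossible. -/
lemma orient_neg {δ y0 y1 y2 : ℝ} (hδ : 0 < δ) (h01 : y0 < y1) (h12 : y1 < y2)
    (h20 : y2 < y0 + 2 * Real.pi) {Φ : ℕ → ℂ → Option ℂ} (hΦ : ∀ k, Cls δ y0 y1 y2 (Φ k))
    (ha : ∀ z ∈ Rect δ y0 y1, STo (fun k => Φ k z) (Option.some 0))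
    (hb : ∀ z ∈ Rect δ y1 y2, STo (fun k => Φ k z) Option.none) : False := by
  choose l hl hP using fun k => cls_log h20 (by linarith) (by linarith) (hΦ k).rot1
  obtain ⟨φ, hφ, hone⟩ := rect_one hδ h20 (by linarith) l hl
    (isOpen_Rect δ (y0 + 2 * Real.pi) (y1 + 2 * Real.pi))
    ⟨_, midp_mem hδ (by linarith)⟩ (Rect_mono h20.le le_rfl) (fun z hz => ne_of_gt hz.2.1) (by
      intro z hz
      apply STo_exp_one
      have h1 := (ha _ (rect_sub hz)).tau
      have hz' : z ∈ Rect δ y2 (y1 + 2 * Real.pi) := Rect_mono h20.le le_rfl hz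
      rw [tau_some_zero] at h1
      simpa only [(hΦ _).sub, hP _ z hz'] using h1)
  have hmc := midp_mem hδ h20
  have hmc1 : midp y2 (y0 + 2 * Real.pi) ∈ Rect δ y2 (y1 + 2 * Real.pi) :=
    Rect_mono le_rfl (by linarith) hmc
  have c1 : STo (fun k => Φ (φ k) (midp y2 (y0 + 2 * Real.pi))) (Option.some 0) := by
    have h1 := STo_some_iff.mpr (hone _ hmc1)
    simp only [← hP _ _ hmc1] at h1
    have := h1.untau
    rwa [tau_some_one, tau_none] at this
  choose l' hl' hP' using fun k => cls_log h12 h20 (by linarith) (hΦ (φ k)).rot2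
  obtain ⟨ψ, hψ, hone'⟩ := rect_one hδ h12 h20 l' hl'
    (isOpen_Rect δ y1 y2)
    ⟨_, midp_mem hδ h12⟩ (Rect_mono le_rfl h20.le) (fun z hz => ne_of_lt hz.2.2) (by
      intro z hz
      apply STo_exp_one
      have h1 := ((hb _ hz).comp hφ).tau.tau
      have hz' : z ∈ Rect δ y1 (y0 + 2 * Real.pi) := Rect_mono le_rfl h20.le hz
      rw [tau_none, tau_some_zero] at h1
      simpa only [hP' _ z hz'] using h1)
  have hmc2 : midp y2 (y0 + 2 * Real.pi) ∈ Rect δ y1 (y0 + 2 * Real.pi) :=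
    Rect_mono h12.le le_rfl hmc
  have c2 : STo (fun k => Φ (φ (ψ k)) (midp y2 (y0 + 2 * Real.pi))) Option.none := by
    have h1 := (STo_some_iff.mpr (hone' _ hmc2)).tau
    simp only [← hP' _ _ hmc2, tau_tau_tau] at h1
    rwa [tau_some_one] at h1
  simpa using (c1.comp hψ).unique c2

/-- Failure of equicontinuity at a point. -/
def Bad (Φ : ℕ → ℂ → Option ℂ) (z : ℂ) : Prop :=
  ∃ ε > (0 : ℝ), ∃ w : ℕ → ℂ, Tendsto w atTop (𝓝 z) ∧
    ∀ k, ε ≤ dist (emb (Φ k (w k))) (emb (Φ k z))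

lemma not_bad_of_lim {x y : ℕ → Option ℂ} {p : Option ℂ} {φ : ℕ → ℕ} {ε : ℝ} (hε : 0 < ε)
    (h : ∀ k, ε ≤ dist (emb (x k)) (emb (y k)))
    (hx : STo (fun k => x (φ k)) p) (hy : STo (fun k => y (φ k)) p) : False := by
  have h1 := Tendsto.dist hx hy
  rw [dist_self] at h1
  obtain ⟨k, hk⟩ := (h1.eventually_lt_const hε).exists
  linarith [h (φ k)]

lemma cross {δ y0 y1 y2 : ℝ} (hδ : 0 < δ) (h01 : y0 < y1) (h12 : y1 < y2)
    (h20 : y2 < y0 + 2 * Real.pi) {Φ : ℕ → ℂ → Option ℂ} (hΦ : ∀ k, Cls δ y0 y1 y2 (Φ k))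
    {z : ℂ} (hz : z ∈ Rect δ y0 y2) (hbad : Bad Φ z) :
    ∃ φ : ℕ → ℕ, StrictMono φ ∧ Canon y0 y1 y2 (fun k => Φ (φ k)) := by
  obtain ⟨ε, hε, w', hw', hd'⟩ := hbad
  obtain ⟨N, hN⟩ := eventually_atTop.mp (hw'.eventually ((isOpen_Rect δ y0 y2).mem_nhds hz))
  set Ψ : ℕ → ℂ → Option ℂ := fun k => Φ (k + N) with hΨ
  set w : ℕ → ℂ := fun k => w' (k + N) with hw_def
  have hw : Tendsto w atTop (𝓝 z) := hw'.comp (tendsto_add_atTop_nat N)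
  have hwR : ∀ k, w k ∈ Rect δ y0 y2 := fun k => hN _ (Nat.le_add_left _ _)
  have hd : ∀ k, ε ≤ dist (emb (Ψ k (w k))) (emb (Ψ k z)) := fun k => hd' _
  have hcls : ∀ k, Cls δ y0 y1 y2 (Ψ k) := fun k => hΦ _
  suffices hs : ∃ φ : ℕ → ℕ, StrictMono φ ∧ Canon y0 y1 y2 (fun k => Ψ (φ k)) by
    obtain ⟨φ, hφ, hc⟩ := hs
    exact ⟨fun k => φ k + N, hφ.add_const N, hc⟩
  choose l hl hP using fun k => cls_log h01 h12 h20 (hcls k)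
  have hPz : ∀ k, Ψ k z = Option.some (Complex.exp (l k z)) := fun k => hP k z hz
  have hPw : ∀ k, Ψ k (w k) = Option.some (Complex.exp (l k (w k))) := fun k => hP k _ (hwR k)
  obtain ⟨φ, hφ, hcase | ⟨B, hB⟩⟩ := mag_cases (a := y0) (y := y1) (b := y2) l
  · obtain ⟨ψ, hψ, H, hH, hconv, σ₁, σ₂, hs1, hs2, hp1, hp2, hS1, hS2⟩ :=
      cls_big hδ h01 h12 (Φ := fun k => Ψ (φ k)) (fun k => hl (φ k)) (fun k => hP (φ k)) hcase
    have hM' := hcase.comp hψ.tendsto_atTop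
    have hχ : StrictMono (fun k => φ (ψ k)) := hφ.comp hψ
    by_cases hre : (H z).re = 0
    · have hopp : σ₂ = -σ₁ := by
        by_contra hne
        have heq : σ₂ = σ₁ := by
          rcases hs1 with rfl | rfl <;> rcases hs2 with rfl | rfl <;> simp at hne ⊢
        have := same_sign (σ := σ₁) hH hp1 (heq ▸ hp2) z hz
        rw [hre, mul_zero] at this
        exact lt_irrefl _ this
      rcases hs1 with rfl | rfl
      · rw [hopp, pt_neg] at hS2
        rw [pt_one] at hS1
        obtain ⟨χ, hχ', hc⟩ := orient_pos hδ h01 h12 h20 (Φ := fun k => Ψ (φ (ψ k)))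
          (fun k => hcls _) (hS1 _ (midp_mem hδ h01)) (hS2 _ (midp_mem hδ h12))
        exact ⟨fun k => φ (ψ (χ k)), hχ.comp hχ', hc⟩
      · rw [hopp, neg_neg, pt_one] at hS2
        rw [pt_neg] at hS1
        exact (orient_neg hδ h01 h12 h20 (Φ := fun k => Ψ (φ (ψ k)))
          (fun k => hcls _) hS1 hS2).elim
    · exfalso
      obtain ⟨σ, hσ, hpos⟩ : ∃ σ : ℝ, (σ = 1 ∨ σ = -1) ∧ 0 < σ * (H z).re := by
        rcases lt_or_gt_of_ne hre with h | h
        · exact ⟨-1, Or.inr rfl, by linarith⟩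
        · exact ⟨1, Or.inl rfl, by linarith⟩
      have c1 := re_lim hM' (hconv z hz (fun _ => z) tendsto_const_nhds) hσ hpos
      have c2 := re_lim hM' (hconv z hz (fun k => w (φ (ψ k)))
        (hw.comp hχ.tendsto_atTop)) hσ hpos
      simp only [← hPz] at c1
      simp only [← hPw] at c2
      exact not_bad_of_lim hε hd c2 c1
  · exfalso
    obtain ⟨ψ, hψ, H, hH, hconv⟩ := rect_small hδ h01 h12 (fun k => l (φ k))
      (fun k => hl (φ k)) B hB
    have hχ : StrictMono (fun k => φ (ψ k)) := hφ.comp hψ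
    have c1 := STo_some_iff.mpr (hconv z hz (fun _ => z) tendsto_const_nhds)
    have c2 := STo_some_iff.mpr (hconv z hz (fun k => w (φ (ψ k))) (hw.comp hχ.tendsto_atTop))
    simp only [← hPz] at c1
    simp only [← hPw] at c2
    exact not_bad_of_lim hε hd c2 c1

lemma Bad.tau {Φ : ℕ → ℂ → Option ℂ} {z : ℂ} (h : Bad Φ z) :
    Bad (fun k z => _root_.tau (Φ k z)) z := by
  obtain ⟨ε, hε, w, hw, hd⟩ := h
  have huc := isCompact_Sph.uniformContinuousOn_of_continuous continuousOn_tT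
  rw [Metric.uniformContinuousOn_iff] at huc
  obtain ⟨ε₁, hε₁, h1⟩ := huc ε hε
  obtain ⟨ε₂, hε₂, h2⟩ := huc ε₁ hε₁
  refine ⟨ε₂, hε₂, w, hw, fun k => ?_⟩
  by_contra hc
  push Not at hc
  have a1 := h2 _ (emb_mem _) _ (emb_mem _) hc
  rw [← emb_tau, ← emb_tau] at a1
  have a2 := h1 _ (emb_mem _) _ (emb_mem _) a1
  rw [← emb_tau, ← emb_tau, tau_tau_tau, tau_tau_tau] at a2
  linarith [hd k]

lemma Canon.of_rot1 {δ y0 y1 y2 : ℝ} {Φ : ℕ → ℂ → Option ℂ} (hΦ : ∀ k, Cls δ y0 y1 y2 (Φ k))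
    (h : Canon y2 (y0 + 2 * Real.pi) (y1 + 2 * Real.pi) (fun k z => _root_.tau (Φ k z))) :
    Canon y0 y1 y2 Φ := by
  obtain ⟨h1, h2, h3⟩ := h
  simp only [midp_shift, (hΦ _).per] at h2 h3
  refine ⟨?_, ?_, ?_⟩
  · have := h2.untau; rwa [tau_some_zero, tau_some_one] at this
  · have := h3.untau; rwa [tau_some_one, tau_none] at this
  · have := h1.untau; rwa [tau_none, tau_some_zero] at this

lemma Canon.rot1 {δ y0 y1 y2 : ℝ} {Φ : ℕ → ℂ → Option ℂ} (hΦ : ∀ k, Cls δ y0 y1 y2 (Φ k))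
    (h : Canon y0 y1 y2 Φ) :
    Canon y2 (y0 + 2 * Real.pi) (y1 + 2 * Real.pi) (fun k z => _root_.tau (Φ k z)) := by
  obtain ⟨h1, h2, h3⟩ := h
  refine ⟨?_, ?_, ?_⟩
  · have := h3.tau; rwa [tau_some_one] at this
  · simp only [midp_shift, (hΦ _).per]
    have := h1.tau; rwa [tau_none] at this
  · simp only [midp_shift, (hΦ _).per]
    have := h2.tau; rwa [tau_some_zero] at this

lemma Canon.of_rot2 {δ y0 y1 y2 : ℝ} {Φ : ℕ → ℂ → Option ℂ} (hΦ : ∀ k, Cls δ y0 y1 y2 (Φ k))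
    (h : Canon y1 y2 (y0 + 2 * Real.pi) (fun k z => _root_.tau (_root_.tau (Φ k z)))) :
    Canon y0 y1 y2 Φ := by
  obtain ⟨h1, h2, h3⟩ := h
  simp only [midp_shift, (hΦ _).per] at h3
  refine ⟨?_, ?_, ?_⟩
  · have := h3.tau; simpa only [tau_tau_tau, tau_some_one] using this
  · have := h1.tau; simpa only [tau_tau_tau, tau_none] using this
  · have := h2.tau; simpa only [tau_tau_tau, tau_some_zero] using this

lemma Canon.rot2 {δ y0 y1 y2 : ℝ} {Φ : ℕ → ℂ → Option ℂ} (hΦ : ∀ k, Cls δ y0 y1 y2 (Φ k))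
    (h : Canon y0 y1 y2 Φ) :
    Canon y1 y2 (y0 + 2 * Real.pi) (fun k z => _root_.tau (_root_.tau (Φ k z))) := by
  obtain ⟨h1, h2, h3⟩ := h
  refine ⟨?_, ?_, ?_⟩
  · have := h2.tau.tau; rwa [tau_some_zero, tau_some_one] at this
  · have := h3.tau.tau; rwa [tau_some_one, tau_none] at this
  · simp only [midp_shift, (hΦ _).per]
    have := h1.tau.tau; rwa [tau_none, tau_some_zero] at this

lemma cross_all {δ y0 y1 y2 : ℝ} (hδ : 0 < δ) (h01 : y0 < y1) (h12 : y1 < y2)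
    (h20 : y2 < y0 + 2 * Real.pi) {Φ : ℕ → ℂ → Option ℂ} (hΦ : ∀ k, Cls δ y0 y1 y2 (Φ k))
    {z : ℂ} (hz : |z.re| < δ) (hbad : Bad Φ z) :
    ∃ φ : ℕ → ℕ, StrictMono φ ∧ Canon y0 y1 y2 (fun k => Φ (φ k)) := by
  obtain ⟨n, hn, -⟩ := existsUnique_add_zsmul_mem_Ioc Real.two_pi_pos z.im y0
  have hper : ∀ k (v : ℂ), Φ k (v + n * (2 * Real.pi * I)) = Φ k v := fun k v =>
    Function.Periodic.int_mul (hΦ k).per n v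
  set z' : ℂ := z + n * (2 * Real.pi * I) with hz'
  have hre : z'.re = z.re := by simp [hz']
  have him : z'.im = z.im + n • (2 * Real.pi) := by simp [hz']
  rw [← him] at hn
  have hbad' : Bad Φ z' := by
    obtain ⟨ε, hε, w, hw, hd⟩ := hbad
    refine ⟨ε, hε, fun k => w k + n * (2 * Real.pi * I), hw.add_const _, fun k => ?_⟩
    rw [hper, hper]; exact hd k
  rw [← hre] at hz
  by_cases c1 : z'.im < y2
  · exact cross hδ h01 h12 h20 hΦ ⟨hz, hn.1, c1⟩ hbad'
  by_cases c2 : z'.im < y0 + 2 * Real.pi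
  · obtain ⟨φ, hφ, hc⟩ := cross hδ h12 h20 (by linarith) (fun k => (hΦ k).rot2)
      ⟨hz, by linarith, c2⟩ hbad'.tau.tau
    exact ⟨φ, hφ, Canon.of_rot2 (fun k => hΦ (φ k)) hc⟩
  · obtain ⟨φ, hφ, hc⟩ := cross hδ h20 (by linarith) (by linarith) (fun k => (hΦ k).rot1)
      ⟨hz, by linarith, by linarith [hn.2]⟩ hbad'.tau
    exact ⟨φ, hφ, Canon.of_rot1 (fun k => hΦ (φ k)) hc⟩

lemma antisym {δ a y b : ℝ} (hδ : 0 < δ) (hab : b - y = y - a) (hyb : y < b) {H : ℂ → ℂ}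
    (hH : DifferentiableOn ℂ H (Rect δ a b))
    (h0 : ∀ z ∈ Rect δ a b, z.im = y → (H z).re = 0) {t : ℝ} (ht : a < t) (ht' : t < b) :
    (H ⟨0, t⟩).re = -(H ⟨0, 2 * y - t⟩).re := by
  set K : ℂ → ℂ := fun v => H (v + 2 * y * I) with hK
  set G : ℂ → ℂ := fun z => H z + (starRingEnd ℂ) (K ((starRingEnd ℂ) z)) with hG
  have hmem : ∀ z ∈ Rect δ a b, (starRingEnd ℂ) z + 2 * y * I ∈ Rect δ a b := by
    rintro z ⟨h1, h2, h3⟩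
    refine ⟨by simpa using h1, ?_, ?_⟩ <;> simp <;> linarith
  have hGd : DifferentiableOn ℂ G (Rect δ a b) := by
    intro z hz
    apply DifferentiableAt.differentiableWithinAt
    have d1 : DifferentiableAt ℂ H z := hH.differentiableAt ((isOpen_Rect δ a b).mem_nhds hz)
    have d2 : DifferentiableAt ℂ K ((starRingEnd ℂ) z) := by
      have : DifferentiableAt ℂ H ((starRingEnd ℂ) z + 2 * y * I) :=
        hH.differentiableAt ((isOpen_Rect δ a b).mem_nhds (hmem z hz))
      exact DifferentiableAt.comp (f := fun v : ℂ => v + 2 * y * I) _ this (by fun_prop)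
    have d3 := d2.conj_conj
    rw [Complex.conj_conj] at d3
    exact d1.add d3
  have hz0 : (⟨0, y⟩ : ℂ) ∈ Rect δ a b := ⟨by simpa using hδ, by simp only; linarith, hyb⟩
  have hline : ∀ z ∈ Rect δ a b, z.im = y → G z = 0 := by
    intro z hz hy
    have e : (starRingEnd ℂ) z + 2 * y * I = z := by
      apply Complex.ext <;> simp; linarith
    have h1 := h0 z hz hy
    simp only [hG, hK, e]
    apply Complex.ext <;> simp [h1]
  have hfreq : ∃ᶠ z in 𝓝[≠] (⟨0, y⟩ : ℂ), G z = 0 := by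
    have ht : Tendsto (fun x : ℝ => (⟨x, y⟩ : ℂ)) (𝓝[≠] 0) (𝓝[≠] (⟨0, y⟩ : ℂ)) := by
      refine tendsto_nhdsWithin_iff.mpr ⟨?_, ?_⟩
      · have hc : Continuous (fun x : ℝ => (⟨x, y⟩ : ℂ)) := by
          have : (fun x : ℝ => (⟨x, y⟩ : ℂ)) = fun x : ℝ => (x : ℂ) + y * I := by
            funext x; apply Complex.ext <;> simp
          rw [this]; fun_prop
        exact (hc.tendsto 0).mono_left nhdsWithin_le_nhds
      · filter_upwards [self_mem_nhdsWithin] with x hx hc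
        exact hx (by simpa using congrArg Complex.re hc)
    refine ht.frequently (Eventually.frequently ?_)
    have : ∀ᶠ x : ℝ in 𝓝[≠] 0, |x| < δ := by
      apply eventually_nhdsWithin_of_eventually_nhds
      have : Tendsto (fun x : ℝ => |x|) (𝓝 0) (𝓝 |0|) := continuous_abs.tendsto 0
      rw [abs_zero] at this
      exact this.eventually_lt_const hδ
    filter_upwards [this] with x hx
    exact hline _ ⟨hx, hz0.2⟩ rfl
  have hzero := (hGd.analyticOnNhd (isOpen_Rect δ a b)).eqOn_zero_of_preconnected_of_frequently_eq_zero
    (convex_Rect δ a b).isPreconnected hz0 hfreq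
  have h1 := hzero (show (⟨0, t⟩ : ℂ) ∈ Rect δ a b from ⟨by simpa using hδ, ht, ht'⟩)
  have e : (starRingEnd ℂ) (⟨0, t⟩ : ℂ) + 2 * y * I = ⟨0, 2 * y - t⟩ := by
    apply Complex.ext <;> simp; ring
  simp only [hG, hK, e] at h1
  have h2 := congrArg Complex.re h1
  simp at h2
  linarith

lemma tau_tau_exp {u v : ℂ} (h : tau (tau (Option.some (Complex.exp u))) =
    Option.some (Complex.exp v)) : Complex.exp v * Complex.exp u = Complex.exp u - 1 := by
  have hu := Complex.exp_ne_zero u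
  by_cases h1 : Complex.exp u = 1
  · simp [tau, h1] at h
    exact absurd h.symm (Complex.exp_ne_zero v)
  · have h2 : (1 - Complex.exp u)⁻¹ ≠ 1 := by
      rw [Ne, inv_eq_one]
      intro hc; exact hu (by linear_combination -hc)
    simp only [tau, h1, h2, if_false, Option.some.injEq] at h
    rw [← h]
    have h3 : 1 - Complex.exp u ≠ 0 := sub_ne_zero.mpr (Ne.symm h1)
    have h4 : 1 - (1 - Complex.exp u)⁻¹ = -Complex.exp u / (1 - Complex.exp u) := by
      field_simp; ring
    rw [h4, inv_div]
    field_simp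
    ring

lemma re_sum_lim {u v : ℕ → ℂ}
    (h : ∀ k, Complex.exp (v k) * Complex.exp (u k) = Complex.exp (u k) - 1)
    (hu : STo (fun k => Option.some (Complex.exp (u k))) (Option.some 0)) :
    Tendsto (fun k => (v k).re + (u k).re) atTop (𝓝 0) := by
  have h1 : Tendsto (fun k => Complex.exp (u k)) atTop (𝓝 0) := STo_some_iff.mp hu
  have h2 : Tendsto (fun k => ‖Complex.exp (u k) - 1‖) atTop (𝓝 1) := by
    have := (h1.sub_const 1).norm
    simpa using this
  have h3 := h2.log one_ne_zero
  rw [Real.log_one] at h3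
  refine h3.congr fun k => ?_
  rw [← h k, ← Complex.exp_add, Complex.norm_exp, Real.log_exp, Complex.add_re]

lemma pt_eq_none {σ : ℝ} (hσ : σ = 1 ∨ σ = -1) (h : pt σ = Option.none) : σ = 1 := by
  rcases hσ with rfl | rfl
  · rfl
  · simp [pt_neg] at h

lemma pt_eq_zero {σ : ℝ} (hσ : σ = 1 ∨ σ = -1) (h : pt σ = Option.some 0) : σ = -1 := by
  rcases hσ with rfl | rfl
  · simp [pt_one] at h
  · rfl

lemma ratio_lim {u v N : ℕ → ℝ} {b : ℝ}
    (hv : Tendsto (fun k => v k / N k) atTop (𝓝 b)) (huv : Tendsto (fun k => v k + u k) atTop (𝓝 0))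
    (hN : Tendsto N atTop atTop) : Tendsto (fun k => u k / N k) atTop (𝓝 (-b)) := by
  have h1 : Tendsto (fun k => (v k + u k) / N k) atTop (𝓝 0) := huv.div_atTop hN
  have h2 := h1.sub hv
  rw [zero_sub] at h2
  exact h2.congr fun k => by ring

lemma canon_gap {δ y0 y1 y2 : ℝ} (hδ : 0 < δ) (h01 : y0 < y1) (h12 : y1 < y2)
    (h20 : y2 < y0 + 2 * Real.pi) {Φ : ℕ → ℂ → Option ℂ} (hΦ : ∀ k, Cls δ y0 y1 y2 (Φ k))
    (hc : Canon y0 y1 y2 Φ) : y1 - y0 ≤ y2 - y1 := by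
  by_contra hgap
  push Not at hgap
  obtain ⟨ha, hb, hcc⟩ := hc
  have ma := midp_mem hδ h01
  have mb := midp_mem hδ h12
  have mc := midp_mem hδ h20
  choose l hl hP using fun k => cls_log h01 h12 h20 (hΦ k)
  have hM : Tendsto (fun k => Mag y0 y1 y2 (l k)) atTop atTop := by
    refine mag_lower (p := Option.none) (Or.inl rfl) ?_
    simpa only [hP _ _ (Rect_mono le_rfl h12.le ma)] using ha
  obtain ⟨φ, hφ, H, hH, hconv, σ₁, σ₂, hs1, hs2, hp1, hp2, hS1, hS2⟩ := cls_big hδ h01 h12 hl hP hM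
  obtain rfl : σ₁ = 1 := pt_eq_none hs1 ((hS1 _ ma).unique (ha.comp hφ))
  obtain rfl : σ₂ = -1 := pt_eq_zero hs2 ((hS2 _ mb).unique (hb.comp hφ))
  have hHline := opp_sign (σ := 1) h01 hH hp1 hp2
  choose l' hl' hP' using fun k => cls_log h12 h20 (by linarith) (hΦ (φ k)).rot2
  have hb2 := (hb.comp hφ).tau.tau
  have hc2 := (hcc.comp hφ).tau.tau
  rw [tau_some_zero, tau_some_one] at hb2
  rw [tau_some_one, tau_none] at hc2
  have hM' : Tendsto (fun k => Mag y1 y2 (y0 + 2 * Real.pi) (l' k)) atTop atTop := by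
    refine mag_lower (p := Option.none) (Or.inl rfl) ?_
    simpa only [← hP' _ _ (Rect_mono le_rfl h20.le mb)] using hb2
  obtain ⟨ψ, hψ, Λ, hΛ, hconv', σ₁, σ₂, hs1', hs2', hp1', hp2', hS1', hS2'⟩ :=
    cls_big hδ h12 h20 (Φ := fun k z => tau (tau (Φ (φ k) z))) hl' hP' hM'
  obtain rfl : σ₁ = 1 := pt_eq_none hs1' ((hS1' _ mb).unique (hb2.comp hψ))
  obtain rfl : σ₂ = -1 := pt_eq_zero hs2' ((hS2' _ mc).unique (hc2.comp hψ))
  have hΛline := opp_sign (σ := 1) h12 hΛ hp1' hp2'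
  set M : ℕ → ℝ := fun k => Mag y0 y1 y2 (l (φ (ψ k))) with hMdef
  set N : ℕ → ℝ := fun k => Mag y1 y2 (y0 + 2 * Real.pi) (l' (ψ k)) with hNdef
  have hN : Tendsto N atTop atTop := hM'.comp hψ.tendsto_atTop
  have hlim1 : ∀ z ∈ Rect δ y1 y2,
      Tendsto (fun k => (l (φ (ψ k)) z).re / M k) atTop (𝓝 (H z).re) := fun z hz =>
    (hconv z (Rect_mono h01.le le_rfl hz) (fun _ => z) tendsto_const_nhds).comp hψ.tendsto_atTop
  have hlim2 : ∀ z ∈ Rect δ y1 y2,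
      Tendsto (fun k => (l (φ (ψ k)) z).re / N k) atTop (𝓝 (-(Λ z).re)) := by
    intro z hz
    have hz1 := Rect_mono h01.le le_rfl hz
    have hz2 := Rect_mono le_rfl h20.le hz
    refine ratio_lim (hconv' z hz2 (fun _ => z) tendsto_const_nhds) ?_ hN
    refine re_sum_lim (fun k => tau_tau_exp ?_) ?_
    · rw [← hP _ z hz1, ← hP' _ z hz2]
    · have := (hS2 z hz).comp hψ
      rw [pt_neg] at this
      simpa only [hP _ z hz1] using this
  have hHb := hp2 _ mb
  have hΛb := hp1' _ mb
  have hratio : Tendsto (fun k => M k / N k) atTop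
      (𝓝 (-(Λ (midp y1 y2)).re / (H (midp y1 y2)).re)) := by
    have hne : (H (midp y1 y2)).re ≠ 0 := by intro h; rw [h] at hHb; simp at hHb
    have h1 := (hlim2 _ mb).div (hlim1 _ mb) hne
    refine h1.congr' ?_
    filter_upwards [(hlim1 _ mb).eventually_ne hne] with k hk
    have h2 : (l (φ (ψ k)) (midp y1 y2)).re ≠ 0 := by intro h; simp [h] at hk
    have h3 : M k ≠ 0 := by intro h; simp [h] at hk
    simp only [Pi.div_apply]
    by_cases h4 : N k = 0
    · simp [h4]
    · field_simp
  set κ : ℝ := -(Λ (midp y1 y2)).re / (H (midp y1 y2)).re with hκ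
  have hκpos : 0 < κ := div_pos_of_neg_of_neg (by linarith) (by linarith)
  have hrel : ∀ z ∈ Rect δ y1 y2, (Λ z).re = -κ * (H z).re := by
    intro z hz
    have h1 := (hlim1 z hz).mul hratio
    have h2 : Tendsto (fun k => (l (φ (ψ k)) z).re / N k) atTop (𝓝 ((H z).re * κ)) := by
      refine h1.congr fun k => ?_
      have h3 : M k ≠ 0 := by
        have := Mag_ge_one y0 y1 y2 (l (φ (ψ k)))
        simp only [hMdef]; linarith
      field_simp
    have := tendsto_nhds_unique (hlim2 z hz) h2
    linarith
  have hcont : Continuous (fun t : ℝ => (⟨0, t⟩ : ℂ)) := by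
    have : (fun t : ℝ => (⟨0, t⟩ : ℂ)) = fun t : ℝ => (t : ℂ) * I := by
      funext x; apply Complex.ext <;> simp
    rw [this]; fun_prop
  have hd0 : |(0 : ℝ)| < δ := by simpa using hδ
  have ev : ∀ᶠ t in 𝓝[<] y2, y1 < t ∧ t < y2 := by
    filter_upwards [Ioo_mem_nhdsLT h12] with t ht using ht
  have lim1 : Tendsto (fun t : ℝ => (Λ ⟨0, t⟩).re) (𝓝[<] y2) (𝓝 0) := by
    have hmem : (⟨0, y2⟩ : ℂ) ∈ Rect δ y1 (y0 + 2 * Real.pi) := ⟨hd0, h12, h20⟩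
    have hca : ContinuousAt Λ (⟨0, y2⟩ : ℂ) :=
      (hΛ.differentiableAt ((isOpen_Rect _ _ _).mem_nhds hmem)).continuousAt
    have h1 : Tendsto (fun t : ℝ => (Λ ⟨0, t⟩).re) (𝓝 y2) (𝓝 (Λ ⟨0, y2⟩).re) :=
      (Complex.continuous_re.tendsto _).comp (hca.tendsto.comp (hcont.tendsto y2))
    rw [hΛline _ hmem rfl] at h1
    exact h1.mono_left nhdsWithin_le_nhds
  have hsym : ∀ t : ℝ, y1 < t → t < y2 → (H ⟨0, t⟩).re = -(H ⟨0, 2 * y1 - t⟩).re := by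
    intro t ht ht'
    have hsub : Rect δ (2 * y1 - y2) y2 ⊆ Rect δ y0 y2 := Rect_mono (by linarith) le_rfl
    exact antisym hδ (by ring) h12 (hH.mono hsub) (fun z hz => hHline z (hsub hz))
      (by linarith) ht'
  have lim2 : Tendsto (fun t : ℝ => (Λ ⟨0, t⟩).re) (𝓝[<] y2)
      (𝓝 (κ * (H ⟨0, 2 * y1 - y2⟩).re)) := by
    have hmem : (⟨0, 2 * y1 - y2⟩ : ℂ) ∈ Rect δ y0 y2 :=
      ⟨hd0, by simp only; linarith, by simp only; linarith⟩
    have hca : ContinuousAt H (⟨0, 2 * y1 - y2⟩ : ℂ) :=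
      (hH.differentiableAt ((isOpen_Rect _ _ _).mem_nhds hmem)).continuousAt
    have hc' : Continuous (fun t : ℝ => (⟨0, 2 * y1 - t⟩ : ℂ)) :=
      hcont.comp (continuous_const.sub continuous_id)
    have h1 : Tendsto (fun t : ℝ => (H ⟨0, 2 * y1 - t⟩).re) (𝓝 y2)
        (𝓝 (H ⟨0, 2 * y1 - y2⟩).re) :=
      (Complex.continuous_re.tendsto _).comp
        (Tendsto.comp (f := fun t : ℝ => (⟨0, 2 * y1 - t⟩ : ℂ)) hca.tendsto (hc'.tendsto y2))
    refine ((h1.mono_left nhdsWithin_le_nhds).const_mul κ).congr' ?_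
    filter_upwards [ev] with t ht
    rw [hrel _ ⟨hd0, ht.1, ht.2⟩, hsym t ht.1 ht.2]
    ring
  have heq := tendsto_nhds_unique lim1 lim2
  have hpos := hp1 ⟨0, 2 * y1 - y2⟩ ⟨hd0, by simp only; linarith, by simp only; linarith⟩
  rw [one_mul] at hpos
  nlinarith [mul_pos hκpos hpos]

lemma canon_eq {δ y0 y1 y2 : ℝ} (hδ : 0 < δ) (h01 : y0 < y1) (h12 : y1 < y2)
    (h20 : y2 < y0 + 2 * Real.pi) {Φ : ℕ → ℂ → Option ℂ} (hΦ : ∀ k, Cls δ y0 y1 y2 (Φ k))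
    (hc : Canon y0 y1 y2 Φ) : y1 = y0 + 2 * Real.pi / 3 ∧ y2 = y0 + 4 * Real.pi / 3 := by
  have g1 := canon_gap hδ h01 h12 h20 hΦ hc
  have g2 := canon_gap hδ h20 (by linarith) (by linarith) (fun k => (hΦ k).rot1) (hc.rot1 hΦ)
  have g3 := canon_gap hδ h12 h20 (by linarith) (fun k => (hΦ k).rot2) (hc.rot2 hΦ)
  constructor <;> linarith

/-- Equicontinuity for angles in the direct order. -/
lemma no_bad {δ y0 y1 y2 : ℝ} (hδ : 0 < δ) (h01 : y0 < y1) (h12 : y1 < y2)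
    (h20 : y2 < y0 + 2 * Real.pi) {Φ : ℕ → ℂ → Option ℂ} (hΦ : ∀ k, Cls δ y0 y1 y2 (Φ k))
    {z : ℂ} (hz : |z.re| < δ) (hbad : Bad Φ z) :
    y1 = y0 + 2 * Real.pi / 3 ∧ y2 = y0 + 4 * Real.pi / 3 := by
  obtain ⟨φ, -, hc⟩ := cross_all hδ h01 h12 h20 hΦ hz hbad
  exact canon_eq hδ h01 h12 h20 (fun k => hΦ (φ k)) hc

lemma Ray_shift (θ : ℝ) (n : ℤ) : Ray (θ + n * (2 * Real.pi)) = Ray θ := by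
  have : Complex.exp (((θ + n * (2 * Real.pi) : ℝ) : ℂ) * I) = Complex.exp ((θ : ℂ) * I) := by
    rw [Complex.exp_eq_exp_iff_exists_int]
    exact ⟨n, by push_cast; ring⟩
  unfold Ray
  rw [this]

lemma Ray_two_pi (θ : ℝ) : Ray (θ + 2 * Real.pi) = Ray θ := by
  simpa using Ray_shift θ 1

lemma Bad.sinv {Φ : ℕ → ℂ → Option ℂ} {z : ℂ} (h : Bad Φ z) :
    Bad (fun k z => _root_.sinv (Φ k z)) z := by
  obtain ⟨ε, hε, w, hw, hd⟩ := h
  refine ⟨ε, hε, w, hw, fun k => ?_⟩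
  have := hd k
  rw [Prod.dist_eq] at this ⊢
  simp only [emb_sinv, dist_neg_neg, Complex.dist_conj_conj]
  exact this

lemma no_bad_rays {δ θ₀ θ₁ θ₂ : ℝ} (hδ : 0 < δ)
    (hd01 : Ray θ₀ ≠ Ray θ₁) (hd02 : Ray θ₀ ≠ Ray θ₂) (hd12 : Ray θ₁ ≠ Ray θ₂)
    (hns : ¬ EquallySpaced (Ray θ₀) (Ray θ₁) (Ray θ₂))
    {Φ : ℕ → ℂ → Option ℂ} (hΦ : ∀ k, Cls δ θ₀ θ₁ θ₂ (Φ k))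
    {z : ℂ} (hz : |z.re| < δ) (hbad : Bad Φ z) : False := by
  obtain ⟨n, hn, -⟩ := existsUnique_add_zsmul_mem_Ioc Real.two_pi_pos θ₁ θ₀
  obtain ⟨m, hm, -⟩ := existsUnique_add_zsmul_mem_Ioc Real.two_pi_pos θ₂ θ₀
  rw [zsmul_eq_mul] at hn hm
  have hR1 := Ray_shift θ₁ n
  have hR2 := Ray_shift θ₂ m
  have hcls := fun k => (hΦ k).shift 0 n m
  rw [Int.cast_zero, zero_mul, add_zero] at hcls
  set t1 := θ₁ + n * (2 * Real.pi) with ht1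
  set t2 := θ₂ + m * (2 * Real.pi) with ht2
  rw [← hR1, ← hR2] at hd12 hns
  rw [← hR1] at hd01
  rw [← hR2] at hd02
  clear_value t1 t2
  have h1 : t1 < θ₀ + 2 * Real.pi :=
    lt_of_le_of_ne hn.2 (fun h => hd01 (by rw [h, Ray_two_pi]))
  have h2 : t2 < θ₀ + 2 * Real.pi :=
    lt_of_le_of_ne hm.2 (fun h => hd02 (by rw [h, Ray_two_pi]))
  have h3 : t1 ≠ t2 := fun h => hd12 (by rw [h])
  rcases lt_or_gt_of_ne h3 with h | h
  · obtain ⟨e1, e2⟩ := no_bad hδ hn.1 h h2 hcls hz hbad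
    exact hns ⟨θ₀, by rw [← e1, ← e2]⟩
  · have hcls' : ∀ k, Cls δ t2 t1 (θ₀ + 2 * Real.pi) (fun z => sinv (Φ k z)) := by
      intro k
      simpa using (hcls k).sinv.shift 0 0 1
    obtain ⟨e1, e2⟩ := no_bad hδ h h1 (by linarith [hm.1]) hcls' hz hbad.sinv
    refine hns ⟨t2, ?_⟩
    rw [← e1, ← e2, Ray_two_pi]
    ext x
    simp only [Set.mem_insert_iff, Set.mem_singleton_iff]
    tauto

lemma chart_toSphere {f : ℂ → ℂ} {P A : Set ℂ} (hA : IsOpen A) (hf : MeromOn f P A) {z : ℂ}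
    (hz : z ∈ A) : Chart (toSphere f P) z := by
  obtain ⟨-, han, hpole, hacc⟩ := hf
  have hev : ∀ᶠ w in 𝓝[≠] z, w ∉ P := by
    have := hacc z hz
    rw [accPt_iff_frequently_nhdsNE] at this
    exact not_frequently.mp this
  by_cases hzP : z ∈ P
  · right
    refine ⟨Function.update (fun w => (f w)⁻¹) z 0, ?_, ?_⟩
    · apply Complex.analyticAt_of_differentiable_on_punctured_nhds_of_continuousAt
      · filter_upwards [hev, self_mem_nhdsWithin, (hpole z hzP).eventually_gt_atTop 0,
          mem_nhdsWithin_of_mem_nhds (hA.mem_nhds hz)] with w h1 h2 h3 h4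
        have h5 : DifferentiableAt ℂ (fun w => (f w)⁻¹) w :=
          (han w ⟨h4, h1⟩).differentiableAt.inv (norm_pos_iff.mp h3)
        refine h5.congr_of_eventuallyEq ?_
        filter_upwards [isOpen_ne.mem_nhds h2] with v hv
        rw [Function.update_of_ne hv]
      · rw [continuousAt_update_same, tendsto_zero_iff_norm_tendsto_zero]
        simp only [norm_inv]
        exact tendsto_inv_atTop_zero.comp (hpole z hzP)
    · rw [eventually_nhdsWithin_iff] at hev
      have h3 := eventually_nhdsWithin_iff.mp ((hpole z hzP).eventually_gt_atTop 0)
      filter_upwards [hev, h3] with w hw h3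
      by_cases hwz : w = z
      · subst hwz
        simp [toSphere, hzP, sinv]
      · have h1 := hw hwz
        have h2 : f w ≠ 0 := norm_pos_iff.mp (h3 hwz)
        simp [toSphere, h1, sinv, h2, Function.update_of_ne hwz]
  · left
    refine ⟨f, han z ⟨hz, hzP⟩, ?_⟩
    rw [eventually_nhdsWithin_iff] at hev
    filter_upwards [hev] with w hw
    have : w ∉ P := by
      by_cases hwz : w = z
      · rwa [hwz]
      · exact hw hwz
    simp [toSphere, this]

lemma Chart.comp {Φ : ℂ → Option ℂ} {E : ℂ → ℂ} {z : ℂ} (h : Chart Φ (E z))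
    (hE : AnalyticAt ℂ E z) : Chart (fun w => Φ (E w)) z := by
  rcases h with ⟨g, hg, h⟩ | ⟨g, hg, h⟩
  · left
    exact ⟨fun w => g (E w), hg.comp hE, hE.continuousAt.eventually h⟩
  · right
    exact ⟨fun w => g (E w), hg.comp hE, hE.continuousAt.eventually h⟩

lemma ray_im {s θ : ℝ} {z : ℂ} (h : Complex.exp (s + z) ∈ Ray θ) :
    ∃ n : ℤ, z.im = θ + n * (2 * Real.pi) := by
  obtain ⟨t, ht, he⟩ := h
  rw [← Real.exp_log ht, Complex.ofReal_exp, ← Complex.exp_add,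
    Complex.exp_eq_exp_iff_exists_int] at he
  obtain ⟨n, hn⟩ := he
  refine ⟨n, ?_⟩
  have := congrArg Complex.im hn
  simpa using this

lemma cls_toSphere {f : ℂ → ℂ} {P A : Set ℂ} (hA : IsOpen A) {θ₀ θ₁ θ₂ δ s : ℝ}
    (hf : MeromOn f P A)
    (h0 : ∀ z ∈ A, z ∉ P → f z = 0 → z ∈ Ray θ₀)
    (h1 : ∀ z ∈ A, z ∉ P → f z = 1 → z ∈ Ray θ₁)
    (h2 : P ⊆ Ray θ₂) (hδ : ∀ z : ℂ, |z.re| < δ → Complex.exp (s + z) ∈ A) :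
    Cls δ θ₀ θ₁ θ₂ (fun z => toSphere f P (Complex.exp (s + z))) where
  chart z hz := (chart_toSphere hA hf (hδ z hz)).comp (E := fun w => Complex.exp (s + w))
    ((analyticAt_const.add analyticAt_id).cexp)
  per z := by
    have : Complex.exp (s + (z + 2 * Real.pi * I)) = Complex.exp (s + z) := by
      rw [← add_assoc, Complex.exp_periodic]
    simp only [this]
  zero z hz hw := by
    have hP : Complex.exp (s + z) ∉ P := by
      intro hc; simp [toSphere, hc] at hw
    simp [toSphere, hP] at hw
    exact ray_im (h0 _ (hδ z hz) hP hw)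
  one z hz hw := by
    have hP : Complex.exp (s + z) ∉ P := by
      intro hc; simp [toSphere, hc] at hw
    simp [toSphere, hP] at hw
    exact ray_im (h1 _ (hδ z hz) hP (by simpa using hw))
  pole z hz hw := by
    have hP : Complex.exp (s + z) ∈ P := by
      by_contra hc; simp [toSphere, hc] at hw
    exact ray_im (h2 hP)

lemma emb_surj {p : ℂ × ℝ} (hp : p ∈ Sph) : ∃ q, emb q = p := by
  obtain ⟨X, Z⟩ := p
  have hp' : Complex.normSq X + Z ^ 2 = 1 := hp
  by_cases hZ : Z = 1
  · refine ⟨Option.none, ?_⟩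
    have : Complex.normSq X = 0 := by rw [hZ] at hp'; linarith
    rw [Complex.normSq_eq_zero] at this
    simp [emb, this, hZ]
  · have hZ1 : Z < 1 := lt_of_le_of_ne (by nlinarith [Complex.normSq_nonneg X]) hZ
    have hpos : 0 < 1 - Z := by linarith
    refine ⟨Option.some (X / ((1 - Z : ℝ) : ℂ)), ?_⟩
    have hn : ‖X / ((1 - Z : ℝ) : ℂ)‖ ^ 2 = (1 + Z) / (1 - Z) := by
      rw [Complex.sq_norm, Complex.normSq_div, Complex.normSq_ofReal]
      have : Complex.normSq X = (1 - Z) * (1 + Z) := by linarith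
      rw [this]; field_simp
    have h2 : 1 + (1 + Z) / (1 - Z) = 2 / (1 - Z) := by field_simp; ring
    have hc : ((1 - Z : ℝ) : ℂ) ≠ 0 := by exact_mod_cast hpos.ne'
    simp only [emb, hn, h2]
    apply Prod.ext
    · simp only
      rw [Complex.ofReal_div]
      generalize ((1 - Z : ℝ) : ℂ) = q at *
      simp only [Complex.ofReal_ofNat]
      field_simp
    · simp only
      field_simp
      ring

lemma sphDist_nonneg (p q : Option ℂ) : 0 ≤ sphDist p q := by
  cases p <;> cases q <;> simp only [sphDist] <;> positivity

lemma sphDist_sq (p q : Option ℂ) : sphDist p q ^ 2 =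
    Complex.normSq ((emb p).1 - (emb q).1) + ((emb p).2 - (emb q).2) ^ 2 := by
  have key : ∀ z : ℂ, (2 / Real.sqrt (1 + ‖z‖ ^ 2)) ^ 2 =
      Complex.normSq (2 * z / ((1 + ‖z‖ ^ 2 : ℝ) : ℂ)) + (2 / (1 + ‖z‖ ^ 2)) ^ 2 := by
    intro z
    rw [div_pow, Real.sq_sqrt (by positivity), Complex.normSq_div, Complex.normSq_ofReal,
      Complex.normSq_mul, ← Complex.sq_norm z]
    have : Complex.normSq 2 = 4 := by norm_num [Complex.normSq_apply]
    rw [this]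
    have h2 : (1 + ‖z‖ ^ 2 : ℝ) ≠ 0 := by positivity
    field_simp
    ring
  cases p with
  | none =>
    cases q with
    | none => simp [sphDist]
    | some w =>
      simp only [sphDist, emb]
      rw [key w, zero_sub, Complex.normSq_neg]
      ring
  | some z =>
    cases q with
    | none =>
      simp only [sphDist, emb]
      rw [key z, sub_zero]
      ring
    | some w =>
      simp only [sphDist, emb]
      rw [div_pow, mul_pow, mul_pow, Real.sq_sqrt (by positivity), Real.sq_sqrt (by positivity),
        dist_eq_norm, Complex.sq_norm (z - w)]
      have ha : (1 + ‖z‖ ^ 2 : ℝ) ≠ 0 := by positivity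
      have hb : (1 + ‖w‖ ^ 2 : ℝ) ≠ 0 := by positivity
      rw [Complex.normSq_apply, Complex.normSq_apply]
      simp only [Complex.sub_re, Complex.sub_im, Complex.div_ofReal_re, Complex.div_ofReal_im,
        Complex.re_ofNat, Complex.im_ofNat, Complex.mul_re, Complex.mul_im, zero_mul, sub_zero,
        add_zero]
      have hz : ‖z‖ ^ 2 = z.re * z.re + z.im * z.im := by
        rw [Complex.sq_norm, Complex.normSq_apply]
      have hw : ‖w‖ ^ 2 = w.re * w.re + w.im * w.im := by
        rw [Complex.sq_norm, Complex.normSq_apply]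
      rw [hz] at ha ⊢
      rw [hw] at hb ⊢
      field_simp
      ring

lemma sphDist_le (p q : Option ℂ) : sphDist p q ≤ 2 * dist (emb p) (emb q) := by
  have h := sphDist_sq p q
  rw [← Complex.sq_norm, ← dist_eq_norm] at h
  have h1 : dist (emb p).1 (emb q).1 ≤ dist (emb p) (emb q) := by
    rw [Prod.dist_eq]; exact le_max_left _ _
  have h2 : |(emb p).2 - (emb q).2| ≤ dist (emb p) (emb q) := by
    rw [Prod.dist_eq, ← Real.dist_eq]; exact le_max_right _ _
  have h3 : ((emb p).2 - (emb q).2) ^ 2 ≤ dist (emb p) (emb q) ^ 2 := by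
    rw [← sq_abs]; gcongr
  have h4 : dist (emb p).1 (emb q).1 ^ 2 ≤ dist (emb p) (emb q) ^ 2 := by gcongr
  have h5 := dist_nonneg (x := emb p) (y := emb q)
  refine (pow_le_pow_iff_left₀ (sphDist_nonneg p q) (by positivity) two_ne_zero).mp ?_
  rw [h, mul_pow]
  nlinarith

lemma main_equicont {θ₀ θ₁ θ₂ : ℝ}
    (hd01 : Ray θ₀ ≠ Ray θ₁) (hd02 : Ray θ₀ ≠ Ray θ₂) (hd12 : Ray θ₁ ≠ Ray θ₂)
    (hns : ¬ EquallySpaced (Ray θ₀) (Ray θ₁) (Ray θ₂)) {A : Set ℂ} (hA : IsOpen A)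
    (f : ℕ → ℂ → ℂ) (P : ℕ → Set ℂ) (hf : ∀ k, MeromOn (f k) (P k) A)
    (h0 : ∀ k, ∀ z ∈ A, z ∉ P k → f k z = 0 → z ∈ Ray θ₀)
    (h1 : ∀ k, ∀ z ∈ A, z ∉ P k → f k z = 1 → z ∈ Ray θ₁)
    (h2 : ∀ k, P k ⊆ Ray θ₂) (hA0 : ∀ z ∈ A, z ≠ 0)
    {z₀ : ℂ} (hz₀ : z₀ ∈ A) {δ : ℝ} (hδ0 : 0 < δ)
    (hδ : ∀ z : ℂ, |z.re| < δ → Complex.exp (Real.log ‖z₀‖ + z) ∈ A) {ε : ℝ} (hε : 0 < ε) :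
    ∃ η > 0, ∀ k, ∀ w ∈ A, dist w z₀ < η →
      dist (emb (toSphere (f k) (P k) w)) (emb (toSphere (f k) (P k) z₀)) ≤ ε := by
  by_contra hcon
  push Not at hcon
  have hp : ∀ n : ℕ, (0 : ℝ) < 1 / ((n : ℝ) + 1) := fun n => by positivity
  choose κ w hwA hwd hwε using fun n : ℕ => hcon (1 / ((n : ℝ) + 1)) (hp n)
  have hwlim : Tendsto w atTop (𝓝 z₀) := by
    rw [tendsto_iff_dist_tendsto_zero]
    exact squeeze_zero (fun n => dist_nonneg) (fun n => (hwd n).le)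
      tendsto_one_div_add_atTop_nhds_zero_nat
  have hz0 := hA0 z₀ hz₀
  have hexp0 : Complex.exp (Real.log ‖z₀‖ + (z₀.arg : ℂ) * I) = z₀ := by
    have : (Real.log ‖z₀‖ : ℂ) + (z₀.arg : ℂ) * I = Complex.log z₀ := rfl
    rw [this, Complex.exp_log hz0]
  set ζ : ℕ → ℂ := fun n => (z₀.arg : ℂ) * I + Complex.log (w n / z₀) with hζ
  have hexp : ∀ n, Complex.exp (Real.log ‖z₀‖ + ζ n) = w n := by
    intro n
    simp only [hζ]
    rw [← add_assoc, Complex.exp_add, hexp0, Complex.exp_log (div_ne_zero (hA0 _ (hwA n)) hz0)]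
    field_simp
  have hζlim : Tendsto ζ atTop (𝓝 ((z₀.arg : ℂ) * I)) := by
    have h3 : Tendsto (fun n => w n / z₀) atTop (𝓝 1) := by
      have := hwlim.div_const z₀
      rwa [div_self hz0] at this
    have h4 := h3.clog (by simp)
    rw [Complex.log_one] at h4
    have := h4.const_add ((z₀.arg : ℂ) * I)
    rwa [add_zero] at this
  refine no_bad_rays hδ0 hd01 hd02 hd12 hns
    (Φ := fun n z => toSphere (f (κ n)) (P (κ n)) (Complex.exp (Real.log ‖z₀‖ + z)))
    (fun n => cls_toSphere hA (hf _) (h0 _) (h1 _) (h2 _) hδ) (z := (z₀.arg : ℂ) * I)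
    (by simpa using hδ0) ⟨ε, hε, ζ, hζlim, fun n => ?_⟩
  simp only [hexp, hexp0]
  exact (hwε n).le

/-- **Theorem 1 (normality direction).** If the three distinct rays are not equally spaced,
then the family of all functions meromorphic in the annulus `A = {r < |z| < R}` with all zeros
on `L₀`, all `1`-points on `L₁` and all poles on `L₂` is normal in `A`. -/
theorem normal_family_three_rays_not_equally_spaced
    (θ₀ θ₁ θ₂ : ℝ)
    (hd01 : Ray θ₀ ≠ Ray θ₁) (hd02 : Ray θ₀ ≠ Ray θ₂) (hd12 : Ray θ₁ ≠ Ray θ₂)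
    (hns : ¬ EquallySpaced (Ray θ₀) (Ray θ₁) (Ray θ₂))
    (r : ℝ) (R : EReal) (hr : 0 ≤ r) (hrR : (r : EReal) < R)
    (A : Set ℂ) (hA : A = {z : ℂ | r < ‖z‖ ∧ ((‖z‖ : ℝ) : EReal) < R}) :
    NormalOn (fun f P => MeromOn f P A ∧
      (∀ z ∈ A, z ∉ P → f z = 0 → z ∈ Ray θ₀) ∧
      (∀ z ∈ A, z ∉ P → f z = 1 → z ∈ Ray θ₁) ∧
      P ⊆ Ray θ₂) A := by
  intro f P hmem
  have hOr : IsOpen {x : ℝ | r < x ∧ (x : EReal) < R} :=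
    (isOpen_lt (g := fun x : ℝ => x) continuous_const continuous_id).inter
      (isOpen_lt (f := fun x : ℝ => (x : EReal)) continuous_coe_real_ereal continuous_const)
  have hAo : IsOpen A := by
    rw [hA]; exact hOr.preimage continuous_norm
  have hA0 : ∀ z ∈ A, z ≠ 0 := by
    intro z hz hc
    rw [hA] at hz
    have : r < ‖z‖ := hz.1
    rw [hc, norm_zero] at this
    linarith
  have hδ : ∀ z₀ ∈ A, ∃ δ > 0, ∀ z : ℂ, |z.re| < δ →
      Complex.exp (Real.log ‖z₀‖ + z) ∈ A := by
    intro z₀ hz₀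
    have hpos : 0 < ‖z₀‖ := norm_pos_iff.mpr (hA0 z₀ hz₀)
    have hcont : Continuous (fun t : ℝ => Real.exp (Real.log ‖z₀‖ + t)) := by fun_prop
    have hO := hOr.preimage hcont
    have h0 : (0 : ℝ) ∈ (fun t : ℝ => Real.exp (Real.log ‖z₀‖ + t)) ⁻¹'
        {x : ℝ | r < x ∧ (x : EReal) < R} := by
      show Real.exp (Real.log ‖z₀‖ + 0) ∈ {x : ℝ | r < x ∧ (x : EReal) < R}
      rw [add_zero, Real.exp_log hpos]
      rw [hA] at hz₀
      exact hz₀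
    obtain ⟨δ, hδ, hsub⟩ := Metric.isOpen_iff.mp hO 0 h0
    refine ⟨δ, hδ, fun z hz => ?_⟩
    have h1 := hsub (show z.re ∈ Metric.ball (0 : ℝ) δ by simpa using hz)
    rw [hA]
    show r < ‖Complex.exp (Real.log ‖z₀‖ + z)‖ ∧
      ((‖Complex.exp (Real.log ‖z₀‖ + z)‖ : ℝ) : EReal) < R
    rw [Complex.norm_exp, Complex.add_re, Complex.ofReal_re]
    exact h1
  obtain ⟨φ, hφ, g, hg⟩ := ascoli_seq hAo (fun k z => emb (toSphere (f k) (P k) z))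
    (fun z _ => ⟨Sph, isCompact_Sph, fun k => emb_mem _⟩) (by
      intro z₀ hz₀ ε hε
      obtain ⟨δ, hδ0, hδ⟩ := hδ z₀ hz₀
      exact main_equicont hd01 hd02 hd12 hns hAo f P (fun k => (hmem k).1)
        (fun k => (hmem k).2.1) (fun k => (hmem k).2.2.1) (fun k => (hmem k).2.2.2) hA0 hz₀ hδ0
        hδ hε)
  have hgS : ∀ z, ∃ q, z ∈ A → emb q = g z := by
    intro z
    by_cases hz : z ∈ A
    · have hlim := hg.tendsto_at hz
      obtain ⟨q, hq⟩ := emb_surj (isCompact_Sph.isClosed.mem_of_tendsto hlim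
        (Eventually.of_forall fun k => emb_mem _))
      exact ⟨q, fun _ => hq⟩
    · exact ⟨Option.none, fun h => absurd h hz⟩
  choose G hG using hgS
  refine ⟨φ, hφ, G, fun K hKA hK ε hε => ?_⟩
  have hu := (tendstoLocallyUniformlyOn_iff_forall_isCompact hAo).mp hg K hKA hK
  rw [Metric.tendstoUniformlyOn_iff] at hu
  filter_upwards [hu (ε / 2) (by positivity)] with k hk z hz
  have h1 := hk z hz
  rw [← hG z (hKA hz), dist_comm] at h1
  have h2 := sphDist_le (toSphere (f (φ k)) (P (φ k)) z) (G z)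
  linarith
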